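/- arXiv:1805.10562 — 10 statements merged into one kernel-verified Lean document; each statement's English description precedes it below -/
import Mathlib

section
/- Let q be a prime power, m ≥ 2 an integer, 1 ≤ h ≤ m−1, and n = q^m − 1. Suppose e is a divisor of n with 2 ≤ e < n such that e does not divide any element of I(q,m,h). Then for every integer l ≥ 1, the minimum distance satisfies d(q, m·l, h) ≤ e. -/
/-- Base-`q` weight of a natural number: the number of nonzero digits in its
base-`q` expansion. -/
def wtq (q a : ℕ) : ℕ := ((Nat.digits q a).filter (fun d => d ≠ 0)).length

/-- `I(q,m,h)`: the set of integers `a` with `1 ≤ a ≤ q^m - 2` whose base-`q`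
weight is at most `h`. -/
def Iset (q m h : ℕ) : Set ℕ := {a | 1 ≤ a ∧ a ≤ q ^ m - 2 ∧ wtq q a ≤ h}

/-- Hamming weight of a coefficient vector: the number of nonzero coordinates. -/
noncomputable def hwt {R : Type*} [Zero R] {n : ℕ} (c : Fin n → R) : ℕ :=
  Set.ncard {i | c i ≠ 0}

/-- Membership in the code `Ω(q,m,h)` with respect to the primitive element `α`
of `L = F_{q^m}`: the polynomial `c(x) = ∑ c_i x^i` (coefficients in `K = F_q`)
vanishes at `α^a` for all `a ∈ I(q,m,h)`. -/
def inOmega {K L : Type*} [Field K] [Field L] [Algebra K L] (q m h : ℕ) (α : L)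
    (c : Fin (q ^ m - 1) → K) : Prop :=
  ∀ a ∈ Iset q m h, ∑ i, algebraMap K L (c i) * α ^ (a * (i : ℕ)) = 0

/-- Membership in the code `Ω̄(q,m,h)` with respect to the primitive element `α`
of `L = F_{q^m}`: the polynomial `c(x) = ∑ c_i x^i` (coefficients in `K = F_q`)
vanishes at `1` and at `α^a` and `α^{-a}` for all `a ∈ I(q,m,h)`. -/
def inOmegaBar {K L : Type*} [Field K] [Field L] [Algebra K L] (q m h : ℕ) (α : L)
    (c : Fin (q ^ m - 1) → K) : Prop :=
  (∑ i, algebraMap K L (c i) = 0) ∧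
  ∀ a ∈ Iset q m h,
    (∑ i, algebraMap K L (c i) * α ^ (a * (i : ℕ)) = 0) ∧
    (∑ i, algebraMap K L (c i) * α⁻¹ ^ (a * (i : ℕ)) = 0)

theorem wtq_eq_mod_add_div {q : ℕ} (hq : 1 < q) (n : ℕ) :
    wtq q n = (if n % q = 0 then 0 else 1) + wtq q (n / q) := by
  rcases Nat.eq_zero_or_pos n with rfl | hn
  · simp [wtq]
  · unfold wtq
    rw [Nat.digits_def' hq hn]
    by_cases h : n % q = 0
    · simp [h]
    · simp [h, add_comm]

theorem wtq_succ_le {q : ℕ} (hq : 1 < q) (x : ℕ) : wtq q (x + 1) ≤ wtq q x + 1 := by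
  induction x using Nat.strong_induction_on with
  | _ x ih =>
    rw [wtq_eq_mod_add_div hq (x + 1), wtq_eq_mod_add_div hq x]
    have hlt := Nat.mod_lt x (by lia : 0 < q)
    by_cases hc : x % q + 1 < q
    · have hdiv : (x + 1) / q = x / q := by
        rw [Nat.add_div (by lia), Nat.mod_eq_of_lt hq, if_neg (by lia), Nat.div_eq_of_lt hq]
        simp
      rw [hdiv]
      split_ifs <;> lia
    · have hx : 0 < x := Nat.pos_of_ne_zero (by rintro rfl; simp at hc; lia)
      have hdiv : (x + 1) / q = x / q + 1 := by
        rw [Nat.add_div (by lia), Nat.mod_eq_of_lt hq, if_pos (by lia), Nat.div_eq_of_lt hq]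
      have hmod : (x + 1) % q = 0 := by
        rw [Nat.add_mod, Nat.mod_eq_of_lt hq, show x % q + 1 = q by lia, Nat.mod_self]
      have := ih (x / q) (Nat.div_lt_self hx hq)
      rw [hdiv, if_pos hmod, if_neg (by lia)]
      lia

theorem wtq_add_le {q : ℕ} (hq : 1 < q) (x y : ℕ) : wtq q (x + y) ≤ wtq q x + wtq q y := by
  induction x using Nat.strong_induction_on generalizing y with
  | _ x ih =>
    rcases Nat.eq_zero_or_pos x with rfl | hx
    · simp
    have hrec := ih (x / q) (Nat.div_lt_self hx hq) (y / q)
    rw [wtq_eq_mod_add_div hq (x + y), wtq_eq_mod_add_div hq x, wtq_eq_mod_add_div hq y,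
      Nat.add_div (by lia)]
    have hxlt := Nat.mod_lt x (by lia : 0 < q)
    have hylt := Nat.mod_lt y (by lia : 0 < q)
    by_cases hc : q ≤ x % q + y % q
    · have hcarry := wtq_succ_le hq (x / q + y / q)
      rw [if_pos hc, if_neg (by lia : x % q ≠ 0), if_neg (by lia : y % q ≠ 0)]
      split_ifs <;> lia
    · have hmod : (x + y) % q = x % q + y % q := by
        rw [Nat.add_mod, Nat.mod_eq_of_lt (by lia)]
      rw [if_neg hc, hmod, add_zero]
      split_ifs <;> lia

theorem wtq_eq_div_pow_add_mod_pow {q : ℕ} (hq : 1 < q) (m n : ℕ) :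
    wtq q n = wtq q (n / q ^ m) + wtq q (n % q ^ m) := by
  induction m generalizing n with
  | zero => simp [wtq, Nat.mod_one]
  | succ m ih =>
    rw [wtq_eq_mod_add_div hq n, wtq_eq_mod_add_div hq (n % q ^ (m + 1)), ih (n / q),
      pow_succ', Nat.mod_mul_right_div_self, Nat.mod_mul_right_mod, Nat.div_div_eq_div_mul]
    lia

theorem wtq_pow_sub_one {q : ℕ} (hq : 1 < q) (m : ℕ) : wtq q (q ^ m - 1) = m := by
  induction m with
  | zero => simp [wtq]
  | succ m ih =>
    have hpos : 0 < q ^ m := by positivity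
    have hsplit : q ^ (m + 1) - 1 = (q - 1) + q * (q ^ m - 1) := by
      rw [pow_succ', Nat.mul_sub, mul_one]
      have := Nat.le_mul_of_pos_right q hpos
      lia
    rw [wtq_eq_mod_add_div hq, hsplit, Nat.add_mul_mod_self_left,
      Nat.add_mul_div_left _ _ (by lia), Nat.mod_eq_of_lt (by lia), Nat.div_eq_of_lt (by lia),
      if_neg (by lia), zero_add, ih, add_comm]

/-- Every positive integer of weight at most `h < m` is congruent modulo `q ^ m - 1` to an
element of `I(q,m,h)`. -/
theorem exists_mem_Iset_modEq {q m h : ℕ} (hq : 1 < q) (hhm : h < m) {a : ℕ} (ha : 0 < a)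
    (hwt : wtq q a ≤ h) : ∃ b ∈ Iset q m h, b ≡ a [MOD q ^ m - 1] := by
  induction a using Nat.strong_induction_on with
  | _ a ih =>
    by_cases hlt : a < q ^ m
    · have hne : a ≠ q ^ m - 1 := by
        rintro rfl
        rw [wtq_pow_sub_one hq] at hwt
        lia
      exact ⟨a, ⟨ha, by lia, hwt⟩, rfl⟩
    · have hpow : 1 < q ^ m := Nat.one_lt_pow (by lia) hq
      have hdiv : 0 < a / q ^ m := Nat.div_pos (by lia) (by lia)
      obtain ⟨k, hk⟩ : ∃ k, q ^ m = k + 1 := ⟨q ^ m - 1, by lia⟩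
      have hdecomp : a = a / q ^ m + a % q ^ m + (q ^ m - 1) * (a / q ^ m) := by
        have := Nat.div_add_mod a (q ^ m)
        have hexp : q ^ m * (a / q ^ m) = (q ^ m - 1) * (a / q ^ m) + a / q ^ m := by
          rw [Nat.sub_mul, one_mul,
            Nat.sub_add_cancel (Nat.le_mul_of_pos_left _ (by lia))]
        lia
      have hprod : 0 < (q ^ m - 1) * (a / q ^ m) := Nat.mul_pos (by lia) hdiv
      obtain ⟨b, hb, hba⟩ := ih (a / q ^ m + a % q ^ m) (by lia) (by lia)
        ((wtq_add_le hq _ _).trans (by rwa [← wtq_eq_div_pow_add_mod_pow hq]))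
      refine ⟨b, hb, hba.trans ?_⟩
      conv_rhs => rw [hdecomp]
      simp [Nat.ModEq]

/-- If `α` has order `e * k` and `e ∤ a`, then `∑ j < e, X ^ (k * j)` vanishes at `α ^ a`. -/
theorem sum_pow_mul_eq_zero_of_not_dvd {L : Type*} [Field L] {α : L} {e k a : ℕ}
    (hα : orderOf α = e * k) (hk : 0 < k) (ha : ¬ e ∣ a) :
    ∑ j ∈ Finset.range e, α ^ (a * (k * j)) = 0 := by
  have hne : α ^ (a * k) ≠ 1 := fun h ↦
    ha (Nat.dvd_of_mul_dvd_mul_right hk (hα ▸ orderOf_dvd_of_pow_eq_one h))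
  have hpow : (α ^ (a * k)) ^ e = 1 := by
    rw [← pow_mul, show a * k * e = e * k * a by ring, pow_mul, ← hα, pow_orderOf_eq_one, one_pow]
  have hgeom := mul_geom_sum (α ^ (a * k)) e
  rw [hpow, sub_self] at hgeom
  simpa [← pow_mul, mul_assoc] using
    (mul_eq_zero.mp hgeom).resolve_left (sub_ne_zero.mpr hne)

/-- If `e ∣ q^m - 1`, `2 ≤ e < q^m - 1`, and `e` divides no element of
`I(q,m,h)`, then for every `l ≥ 1` the minimum distance of `Ω(q, m·l, h)` is at most `e`,
i.e. there is a nonzero codeword of Hamming weight at most `e`. -/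
theorem stmt0 (q m h e : ℕ) (hq : IsPrimePow q) (hm : 2 ≤ m)
    (hh1 : 1 ≤ h) (hh2 : h ≤ m - 1)
    (hdvd : e ∣ q ^ m - 1) (he2 : 2 ≤ e) (helt : e < q ^ m - 1)
    (hnd : ∀ a ∈ Iset q m h, ¬ e ∣ a)
    (l : ℕ) (hl : 1 ≤ l)
    (K L : Type) [Field K] [Fintype K] [Field L] [Fintype L] [Algebra K L]
    (hcardK : Fintype.card K = q) (hcardL : Fintype.card L = q ^ (m * l))
    (α : L) (hα : orderOf α = q ^ (m * l) - 1) :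
    ∃ c : Fin (q ^ (m * l) - 1) → K,
      c ≠ 0 ∧ inOmega q (m * l) h α c ∧ hwt c ≤ e := by
  have hq1 : 1 < q := hq.one_lt
  obtain ⟨k, hk⟩ : e ∣ q ^ (m * l) - 1 :=
    hdvd.trans (by simpa [pow_mul] using Nat.sub_dvd_pow_sub_pow (q ^ m) 1 l)
  have hN : 0 < q ^ (m * l) - 1 :=
    Nat.sub_pos_of_lt (Nat.one_lt_pow (Nat.mul_pos (by lia) hl).ne' hq1)
  have hkpos : 0 < k := Nat.pos_of_ne_zero (by rintro rfl; simp [hk] at hN)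
  have hbound (j : Fin e) : k * j < q ^ (m * l) - 1 := by
    rw [hk, mul_comm e k]
    exact Nat.mul_lt_mul_of_pos_left j.2 hkpos
  let f : Fin e → Fin (q ^ (m * l) - 1) := fun j ↦ ⟨k * j, hbound j⟩
  have hf : Function.Injective f := fun i j hij ↦
    Fin.ext (Nat.eq_of_mul_eq_mul_left hkpos (congrArg Fin.val hij))
  let S : Finset (Fin (q ^ (m * l) - 1)) := Finset.univ.image f
  let c : Fin (q ^ (m * l) - 1) → K := fun i ↦ if i ∈ S then 1 else 0
  refine ⟨c, fun h0 ↦ ?_, fun a ha ↦ ?_, ?_⟩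
  · have := congrFun h0 (f ⟨0, by lia⟩)
    simp [c, S] at this
  · have hea : ¬ e ∣ a := fun hdiv ↦ by
      obtain ⟨b, hb, hba⟩ := exists_mem_Iset_modEq hq1 (by lia : h < m) ha.1 ha.2.2
      exact hnd b hb ((hba.dvd_iff hdvd).mpr hdiv)
    calc ∑ i, algebraMap K L (c i) * α ^ (a * (i : ℕ))
        = ∑ i ∈ S, α ^ (a * (i : ℕ)) := by
          simp only [c, apply_ite (algebraMap K L), map_one, map_zero, ite_mul, one_mul, zero_mul]
          rw [Finset.sum_ite_mem, Finset.univ_inter]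
      _ = ∑ j : Fin e, α ^ (a * (k * (j : ℕ))) := Finset.sum_image hf.injOn
      _ = ∑ j ∈ Finset.range e, α ^ (a * (k * j)) :=
          Fin.sum_univ_eq_sum_range (fun j ↦ α ^ (a * (k * j))) e
      _ = 0 := sum_pow_mul_eq_zero_of_not_dvd (hα.trans hk) hkpos hea
  · have hsupp : {i | c i ≠ 0} = (S : Set (Fin (q ^ (m * l) - 1))) := by
      ext i
      simp [c]
    rw [hwt, hsupp, Set.ncard_coe_finset]
    simpa using Finset.card_image_le (s := Finset.univ) (f := f)
end

section
/- Let q be a prime power, m ≥ 2 an integer, 1 ≤ h ≤ m−1, and n = q^m − 1. Suppose e is a divisor of n with 2 ≤ e < n such that e does not divide any element of I(q,m,h). Then for every integer l ≥ 1, the minimum distance satisfies d̄(q, m·l, h) ≤ 2e. -/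
theorem wtq_mul_add {q : ℕ} (hq : 1 < q) (x : ℕ) {r : ℕ} (hr : r < q) :
    wtq q (q * x + r) = wtq q x + if r = 0 then 0 else 1 := by
  by_cases h : r = 0 ∧ x = 0
  · simp [h.1, h.2, wtq]
  · have hd : Nat.digits q (r + q * x) = r :: Nat.digits q x :=
      Nat.digits_add q hq r x hr (by tauto)
    unfold wtq
    rw [add_comm, hd]
    by_cases h0 : r = 0 <;> simp [h0]

theorem wtq_zero (q : ℕ) : wtq q 0 = 0 := by simp [wtq]

theorem wtq_pow_mul_add {q : ℕ} (hq : 1 < q) (m u : ℕ) {v : ℕ} (hv : v < q ^ m) :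
    wtq q (q ^ m * u + v) = wtq q u + wtq q v := by
  induction m generalizing v with
  | zero =>
    obtain rfl : v = 0 := by simpa using hv
    simp [wtq_zero]
  | succ m ih =>
    have hr := Nat.mod_lt v (by lia : 0 < q)
    have hdiv : v / q < q ^ m := Nat.div_lt_of_lt_mul (by rwa [pow_succ'] at hv)
    have hx := Nat.div_add_mod v q
    generalize v / q = w at *
    generalize v % q = r at *
    subst hx
    have h1 : q ^ (m + 1) * u + (q * w + r) = q * (q ^ m * u + w) + r := by ring
    rw [h1, wtq_mul_add hq _ hr, wtq_mul_add hq _ hr, ih hdiv, add_assoc]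

/-- Folding base-`q` digits modulo `m` does not increase the weight, so avoidance of multiples of
`e` propagates from `I(q,m,h)` to all positive integers of weight at most `h`. -/
theorem not_dvd_of_wtq_le {q m h e : ℕ} (hq : 1 < q) (hm : 1 ≤ m) (hh : h < m)
    (hdvd : e ∣ q ^ m - 1) (hnd : ∀ a ∈ Iset q m h, ¬ e ∣ a) {a : ℕ} (ha : 1 ≤ a)
    (hw : wtq q a ≤ h) : ¬ e ∣ a := by
  induction a using Nat.strong_induction_on with
  | _ a ih =>
    intro hea
    have hp : 1 < q ^ m := Nat.one_lt_pow (by lia) hq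
    rcases lt_trichotomy a (q ^ m - 1) with hlt | heq | hgt
    · exact hnd a ⟨ha, by lia, hw⟩ hea
    · rw [heq, wtq_pow_sub_one hq] at hw
      lia
    · have hv := Nat.mod_lt a (by lia : 0 < q ^ m)
      have hu : 0 < a / q ^ m := Nat.div_pos (by lia) (by lia)
      have hx := Nat.div_add_mod a (q ^ m)
      generalize a / q ^ m = u at *
      generalize a % q ^ m = v at *
      subst hx
      rw [wtq_pow_mul_add hq m u hv] at hw
      refine ih (u + v) (by nlinarith) (by lia) ((wtq_add_le hq u v).trans hw) ?_
      have h1 : q ^ m * u + v = (q ^ m - 1) * u + (u + v) := by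
        obtain ⟨k, hk⟩ := Nat.exists_eq_add_of_lt hp
        rw [hk, show 1 + k + 1 - 1 = k + 1 by lia]
        ring
      rw [h1] at hea
      exact (Nat.dvd_add_right (hdvd.mul_right u)).1 hea

theorem sum_range_mul_mod {R : Type*} [CommSemiring R] (f : ℕ → R) (x : R) (s k : ℕ) :
    ∑ i ∈ Finset.range (s * k), f (i % s) * x ^ i =
      (∑ j ∈ Finset.range k, (x ^ s) ^ j) * ∑ r ∈ Finset.range s, f r * x ^ r := by
  induction k with
  | zero => simp
  | succ k ih =>
    rw [mul_add_one, Finset.sum_range_add, ih, Finset.sum_range_succ, add_mul]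
    congr 1
    rw [Finset.mul_sum]
    refine Finset.sum_congr rfl fun r hr => ?_
    rw [Nat.mul_add_mod, Nat.mod_eq_of_lt (Finset.mem_range.1 hr), pow_add, pow_mul]
    ring

/-- The coefficients of `1 - x`. -/
def oneSubCoeff (K : Type*) [Field K] (r : ℕ) : K := if r = 0 then 1 else if r = 1 then -1 else 0

theorem sum_oneSubCoeff {K L : Type*} [Field K] [Field L] [Algebra K L] {s : ℕ} (hs : 2 ≤ s)
    (x : L) : ∑ r ∈ Finset.range s, algebraMap K L (oneSubCoeff K r) * x ^ r = 1 - x := by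
  obtain ⟨t, rfl⟩ := Nat.exists_eq_add_of_le hs
  rw [Finset.sum_range_add]
  simp [Finset.sum_range_succ, oneSubCoeff, sub_eq_add_neg, show ∀ i, 2 + i ≠ 1 by lia]

theorem sum_codeword {K L : Type*} [Field K] [Field L] [Algebra K L] {s : ℕ} (hs : 2 ≤ s)
    (e : ℕ) (x : L) :
    ∑ i : Fin (s * e), algebraMap K L (oneSubCoeff K (i % s)) * x ^ (i : ℕ) =
      (∑ j ∈ Finset.range e, (x ^ s) ^ j) * (1 - x) := by
  rw [Fin.sum_univ_eq_sum_range
      (fun i => algebraMap K L (oneSubCoeff K (i % s)) * x ^ i) (s * e),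
    sum_range_mul_mod (fun r => algebraMap K L (oneSubCoeff K r)), sum_oneSubCoeff hs]

theorem sum_codeword_eq_zero {K L : Type*} [Field K] [Field L] [Algebra K L] {s e : ℕ}
    (hs : 2 ≤ s) {x : L} (hx1 : x ^ s ≠ 1) (hxe : x ^ (s * e) = 1) :
    ∑ i : Fin (s * e), algebraMap K L (oneSubCoeff K (i % s)) * x ^ (i : ℕ) = 0 := by
  rw [sum_codeword hs, geom_sum_eq hx1, ← pow_mul, hxe, sub_self, zero_div, zero_mul]

theorem hwt_codeword_le (K : Type*) [Field K] (s e : ℕ) :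
    hwt (fun i : Fin (s * e) => oneSubCoeff K (i % s)) ≤ 2 * e := by
  have hcard : ((Finset.range 2 ×ˢ Finset.range e : Finset (ℕ × ℕ)) : Set (ℕ × ℕ)).ncard
      = 2 * e := by
    rw [Set.ncard_coe_finset]; simp
  rw [← hcard]
  refine Set.ncard_le_ncard_of_injOn (fun i => ((i : ℕ) % s, (i : ℕ) / s)) ?_ ?_
    (Finset.finite_toSet _)
  · intro i hi
    have hi' : oneSubCoeff K (i % s) ≠ 0 := hi
    have hdiv : (i : ℕ) / s < e := Nat.div_lt_of_lt_mul i.2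
    have hmod : (i : ℕ) % s < 2 := by
      by_contra hge
      exact hi' (by rw [oneSubCoeff, if_neg (by lia), if_neg (by lia)])
    simp [hdiv, hmod]
  · intro i _ j _ hij
    obtain ⟨h1, h2⟩ := Prod.mk.inj hij
    exact Fin.ext (by rw [← Nat.div_add_mod (i : ℕ) s, ← Nat.div_add_mod (j : ℕ) s, h1, h2])

theorem exists_codeword (K : Type*) {L : Type*} [Field K] [Field L] [Algebra K L] {N s e : ℕ}
    (hN : N = s * e) (hs : 2 ≤ s) (he : 1 ≤ e) :
    ∃ c : Fin N → K, c ≠ 0 ∧ (∑ i, algebraMap K L (c i) = 0) ∧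
      (∀ x : L, x ^ s ≠ 1 → x ^ N = 1 → ∑ i, algebraMap K L (c i) * x ^ (i : ℕ) = 0) ∧
      hwt c ≤ 2 * e := by
  subst hN
  refine ⟨fun i => oneSubCoeff K (i % s), fun h => ?_, ?_,
    fun x => sum_codeword_eq_zero hs, hwt_codeword_le K s e⟩
  · have h0 := congrFun h ⟨0, by positivity⟩
    simp [oneSubCoeff] at h0
  · simpa using sum_codeword (K := K) hs e (1 : L)

/-- If `e ∣ q^m - 1`, `2 ≤ e < q^m - 1`, and `e` divides no element of
`I(q,m,h)`, then for every `l ≥ 1` the minimum distance of `Ω̄(q, m·l, h)` is at most `2e`,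
i.e. there is a nonzero codeword of Hamming weight at most `2e`. -/
theorem stmt1 (q m h e : ℕ) (hq : IsPrimePow q) (hm : 2 ≤ m)
    (hh1 : 1 ≤ h) (hh2 : h ≤ m - 1)
    (hdvd : e ∣ q ^ m - 1) (he2 : 2 ≤ e) (helt : e < q ^ m - 1)
    (hnd : ∀ a ∈ Iset q m h, ¬ e ∣ a)
    (l : ℕ) (hl : 1 ≤ l)
    (K L : Type) [Field K] [Fintype K] [Field L] [Fintype L] [Algebra K L]
    (hcardK : Fintype.card K = q) (hcardL : Fintype.card L = q ^ (m * l))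
    (α : L) (hα : orderOf α = q ^ (m * l) - 1) :
    ∃ c : Fin (q ^ (m * l) - 1) → K,
      c ≠ 0 ∧ inOmegaBar q (m * l) h α c ∧ hwt c ≤ 2 * e := by
  have hq1 : 1 < q := hq.one_lt
  have hN : q ^ m - 1 ∣ q ^ (m * l) - 1 := by
    simpa [pow_mul] using Nat.sub_dvd_pow_sub_pow (q ^ m) 1 l
  have hNpos : 0 < q ^ (m * l) - 1 :=
    Nat.sub_pos_of_lt (Nat.one_lt_pow (by positivity) hq1)
  have hle := Nat.le_of_dvd hNpos hN
  obtain ⟨s, hs⟩ := hdvd.trans hN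
  rw [mul_comm e s] at hs
  have hs2 : 2 ≤ s := by
    by_contra hlt
    have : s * e ≤ 1 * e := Nat.mul_le_mul_right e (by lia)
    lia
  have key : ∀ a ∈ Iset q (m * l) h, ∀ γ : L, orderOf γ = q ^ (m * l) - 1 →
      (γ ^ a) ^ s ≠ 1 ∧ (γ ^ a) ^ (q ^ (m * l) - 1) = 1 := by
    rintro a ⟨ha1, -, haw⟩ γ hγ
    constructor
    · rw [← pow_mul, Ne, ← orderOf_dvd_iff_pow_eq_one, hγ, hs, mul_comm a s,
        Nat.mul_dvd_mul_iff_left (by lia)]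
      exact not_dvd_of_wtq_le hq1 (by lia) (by lia) hdvd hnd ha1 haw
    · rw [← pow_mul, ← orderOf_dvd_iff_pow_eq_one, hγ]
      exact dvd_mul_left _ _
  have hα' : orderOf α⁻¹ = q ^ (m * l) - 1 := by
    rw [← hα]
    exact orderOf_eq_orderOf_iff.2 fun n => by rw [inv_pow, inv_eq_one]
  obtain ⟨c, hc0, hc1, hc, hcw⟩ := exists_codeword K (L := L) hs hs2 (by lia)
  refine ⟨c, hc0, ⟨hc1, fun a ha => ⟨?_, ?_⟩⟩, hcw⟩
  · simpa only [pow_mul] using hc (α ^ a) (key a ha α hα).1 (key a ha α hα).2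
  · simpa only [pow_mul] using hc (α⁻¹ ^ a) (key a ha α⁻¹ hα').1 (key a ha α⁻¹ hα').2
end

section
/- Let q ≥ 3 and h ≥ 1 be integers and set e = 1 + q + ⋯ + q^h = (q^{h+1} − 1)/(q − 1). Then e does not divide any integer a with 1 ≤ a ≤ q^{h+1} − 2 whose base-q weight is at most h. (Indeed, for 1 ≤ t ≤ q − 2, the base-q weight of t·e equals h + 1.) -/
theorem digits_mul_geom_sum {q t : ℕ} (ht : 0 < t) (htq : t < q) (n : ℕ) :
    Nat.digits q (t * ∑ i ∈ Finset.range n, q ^ i) = List.replicate n t := by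
  induction n with
  | zero => simp
  | succ n ih =>
    have hsum : t * ∑ i ∈ Finset.range (n + 1), q ^ i =
        t + q * (t * ∑ i ∈ Finset.range n, q ^ i) := by
      rw [geom_sum_succ]
      ring
    rw [hsum, Nat.digits_add q (by omega) t _ htq (Or.inl ht.ne'), ih, List.replicate_succ]

theorem wtq_mul_geom_sum {q t : ℕ} (ht : 0 < t) (htq : t < q) (n : ℕ) :
    wtq q (t * ∑ i ∈ Finset.range n, q ^ i) = n := by
  simp [wtq, digits_mul_geom_sum ht htq, ht.ne']

/-- For `q ≥ 3`, `h ≥ 1`, and `e = 1 + q + ⋯ + q^h`, the number `e` divides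
no integer `a` with `1 ≤ a ≤ q^{h+1} - 2` of base-`q` weight at most `h`; indeed for
`1 ≤ t ≤ q - 2` the base-`q` weight of `t·e` equals `h + 1`. -/
theorem stmt7 (q h : ℕ) (hq : 3 ≤ q) (hh : 1 ≤ h) :
    (∀ a : ℕ, 1 ≤ a → a ≤ q ^ (h + 1) - 2 → wtq q a ≤ h →
      ¬ (∑ i ∈ Finset.range (h + 1), q ^ i) ∣ a) ∧
    (∀ t : ℕ, 1 ≤ t → t ≤ q - 2 →
      wtq q (t * ∑ i ∈ Finset.range (h + 1), q ^ i) = h + 1) := by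
  refine ⟨fun a ha hle hw hdvd => ?_, fun t ht htq => wtq_mul_geom_sum ht (by omega) _⟩
  obtain ⟨t, rfl⟩ := hdvd
  rw [mul_comm] at ha hle hw
  have ht : 0 < t := Nat.pos_of_mul_pos_right ha
  have htq : t < q := by
    by_contra! hqt
    have hmul : q * q ^ h ≤ t * ∑ i ∈ Finset.range (h + 1), q ^ i :=
      Nat.mul_le_mul hqt
        (Finset.single_le_sum_of_canonicallyOrdered (Finset.self_mem_range_succ h))
    have hpos : 0 < q ^ (h + 1) := Nat.pow_pos (by omega)
    rw [pow_succ'] at hle hpos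
    omega
  rw [wtq_mul_geom_sum ht htq] at hw
  omega
end

section
/- For every integer m ≥ 4, the minimum distance satisfies d̄(2, m, 1) = 6. -/
/-- A positive integer of binary weight at most one is a power of two. -/
lemma exists_eq_two_pow_of_wtq_le_one (a : ℕ) (ha : 1 ≤ a) (h : wtq 2 a ≤ 1) :
    ∃ j, a = 2 ^ j := by
  induction a using Nat.strong_induction_on with
  | _ a ih =>
    unfold wtq at h ih
    rw [Nat.digits_def' (by norm_num) ha] at h
    rcases Nat.mod_two_eq_zero_or_one a with h0 | h1
    · rw [h0, List.filter_cons_of_neg (by simp)] at h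
      obtain ⟨j, hj⟩ := ih (a / 2) (by omega) (by omega) h
      exact ⟨j + 1, by rw [pow_succ]; omega⟩
    · rw [h1, List.filter_cons_of_pos (by simp), List.length_cons] at h
      rcases Nat.eq_zero_or_pos (a / 2) with h2 | h2
      · exact ⟨0, by simp; omega⟩
      · have hlast := Nat.getLast_digit_ne_zero 2 h2.ne'
        have hnil : (Nat.digits 2 (a / 2)).filter (fun d => d ≠ 0) = [] :=
          List.eq_nil_of_length_eq_zero (by omega)
        rw [List.filter_eq_nil_iff] at hnil
        exact absurd (decide_eq_true hlast) (hnil _ (List.getLast_mem _))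

lemma one_mem_Iset {m : ℕ} (hm : 4 ≤ m) : 1 ∈ Iset 2 m 1 := by
  have : 2 ^ 4 ≤ 2 ^ m := Nat.pow_le_pow_right (by norm_num) hm
  exact ⟨le_rfl, by omega, by simp [wtq]⟩

/-- In characteristic two, the additive subgroup of values of `x ↦ x ^ 2 + s * x`. -/
def quadraticRange {L : Type*} [Field L] [CharP L 2] (s : L) : AddSubgroup L :=
  (AddMonoidHom.mk' (fun x : L => x ^ 2 + s * x) (fun x y => by
    rw [CharTwo.add_sq]; ring)).range

lemma mem_quadraticRange {L : Type*} [Field L] [CharP L 2] {s u : L} :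
    u ∈ quadraticRange s ↔ ∃ x, x ^ 2 + s * x = u := Iff.rfl

lemma index_quadraticRange_le {L : Type*} [Field L] [Fintype L] [CharP L 2] (s : L) :
    (quadraticRange s).index ≤ 2 := by
  classical
  set f : L →+ L := AddMonoidHom.mk' (fun x : L => x ^ 2 + s * x) (fun x y => by
    rw [CharTwo.add_sq]; ring)
  have hk : Nat.card f.ker ≤ 2 := by
    have hsub : (f.ker : Set L) ⊆ (({0, s} : Finset L) : Set L) := by
      intro x hx
      have hx' : x ^ 2 + s * x = 0 := hx
      have : x * (x + s) = 0 := by linear_combination hx'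
      rcases mul_eq_zero.1 this with h | h
      · simp [h]
      · simp [CharTwo.add_eq_zero.1 h]
    calc Nat.card f.ker = (f.ker : Set L).ncard := rfl
      _ ≤ (({0, s} : Finset L) : Set L).ncard := Set.ncard_le_ncard hsub (Finset.finite_toSet _)
      _ ≤ 2 := by rw [Set.ncard_coe_finset]; exact Finset.card_le_two
  have h1 := f.range.card_mul_index
  have h2 := f.ker.card_mul_index
  rw [AddSubgroup.index_ker] at h2
  have hpos : 0 < Nat.card f.range := Nat.card_pos
  change f.range.index ≤ 2
  have : Nat.card f.range * f.range.index = Nat.card f.range * Nat.card f.ker := by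
    rw [h1, mul_comm, h2]
  rw [Nat.eq_of_mul_eq_mul_left hpos this]
  exact hk

lemma exists_pair_of_mem_quadraticRange {L : Type*} [Field L] [CharP L 2] {s u : L}
    (hu : u ≠ 0) (hs : s ≠ 0) (h : u ∈ quadraticRange s) :
    ∃ P : Finset L, P.card = 2 ∧ (∀ w ∈ P, w ^ 2 + s * w = u) ∧ ∑ w ∈ P, w = s ∧
      ∑ w ∈ P, w⁻¹ = s * u⁻¹ := by
  classical
  have h2 : (2 : L) = 0 := CharTwo.two_eq_zero
  obtain ⟨x, rfl⟩ := mem_quadraticRange.1 h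
  have hne : x ≠ x + s := by simpa using hs
  have hx : x ≠ 0 := by
    rintro rfl
    simp at hu
  have hxs : x + s ≠ 0 := by
    intro h0
    exact hu (by linear_combination x * h0)
  refine ⟨{x, x + s}, Finset.card_pair hne, ?_, ?_, ?_⟩
  · intro w hw
    rcases Finset.mem_insert.1 hw with rfl | hw
    · rfl
    · rw [Finset.mem_singleton.1 hw]
      linear_combination (x * s + s ^ 2) * h2
  · rw [Finset.sum_pair hne]
    linear_combination x * h2
  · rw [Finset.sum_pair hne, show x ^ 2 + s * x = x * (x + s) by ring]
    field_simp
    linear_combination x * h2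

/-- In a field of characteristic two with more than eight elements there are six distinct
nonzero elements with vanishing sum and vanishing sum of inverses. -/
lemma exists_card_six_sum_eq_zero {L : Type*} [Field L] [Fintype L] [CharP L 2]
    (hcard : 8 < Fintype.card L) :
    ∃ S : Finset L, S.card = 6 ∧ 0 ∉ S ∧ ∑ x ∈ S, x = 0 ∧ ∑ x ∈ S, x⁻¹ = 0 := by
  classical
  obtain ⟨s, hs⟩ : ∃ s : L, s ∉ ({0, 1} : Finset L) := by
    by_contra! h
    have h1 := Finset.card_le_card (fun x _ => h x : (Finset.univ : Finset L) ⊆ {0, 1})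
    have h2 : ({0, 1} : Finset L).card ≤ 2 := Finset.card_le_two
    rw [Finset.card_univ] at h1
    omega
  have hs0 : s ≠ 0 := fun h => hs (by simp [h])
  have hs1 : s ≠ 1 := fun h => hs (by simp [h])
  obtain ⟨u, hu, hu0⟩ : ∃ u ∈ quadraticRange (1 : L) ⊓ quadraticRange s ⊓
      quadraticRange (1 + s), u ≠ 0 := by
    by_contra! hzero
    have hbot := (AddSubgroup.eq_bot_iff_forall _).2 hzero
    have h1 := AddSubgroup.index_inf_le (H := quadraticRange (1 : L)) (K := quadraticRange s)
    have h2 := AddSubgroup.index_inf_le (H := quadraticRange (1 : L) ⊓ quadraticRange s)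
      (K := quadraticRange (1 + s))
    rw [hbot, AddSubgroup.index_bot, Nat.card_eq_fintype_card] at h2
    have a1 := index_quadraticRange_le (1 : L)
    have a2 := index_quadraticRange_le s
    have a3 := index_quadraticRange_le (1 + s)
    have := Nat.mul_le_mul a1 a2
    have := Nat.mul_le_mul (h1.trans this) a3
    omega
  obtain ⟨⟨h1, h2⟩, h3⟩ := hu
  obtain ⟨P, hP, hPu, hPsum, hPinv⟩ := exists_pair_of_mem_quadraticRange hu0 one_ne_zero h1
  obtain ⟨Q, hQ, hQu, hQsum, hQinv⟩ := exists_pair_of_mem_quadraticRange hu0 hs0 h2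
  obtain ⟨R, hR, hRu, hRsum, hRinv⟩ := exists_pair_of_mem_quadraticRange hu0
    (fun h => hs1 (CharTwo.add_eq_zero.1 h).symm) h3
  have hdisj {t t' w : L} (htt' : t ≠ t') (h : w ^ 2 + t * w = u) (h' : w ^ 2 + t' * w = u) :
      False := by
    have : (t - t') * w = 0 := by linear_combination h - h'
    rcases mul_eq_zero.1 this with h0 | h0
    · exact htt' (sub_eq_zero.1 h0)
    · exact hu0 (by rw [← h, h0]; ring)
  have hPQ : Disjoint P Q := Finset.disjoint_left.2 fun w hw hw' =>
    hdisj hs1.symm (hPu w hw) (hQu w hw')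
  have hPQR : Disjoint (P ∪ Q) R := by
    refine Finset.disjoint_union_left.2 ⟨?_, ?_⟩ <;> refine Finset.disjoint_left.2 fun w hw hw' => ?_
    · exact hdisj (by simpa using hs0) (hPu w hw) (hRu w hw')
    · exact hdisj (by simp) (hQu w hw) (hRu w hw')
  refine ⟨P ∪ Q ∪ R, ?_, ?_, ?_, ?_⟩
  · rw [Finset.card_union_of_disjoint hPQR, Finset.card_union_of_disjoint hPQ, hP, hQ, hR]
  · intro h
    rw [Finset.mem_union, Finset.mem_union] at h
    rcases h with (h | h) | h
    · exact hu0 (by simpa using (hPu 0 h).symm)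
    · exact hu0 (by simpa using (hQu 0 h).symm)
    · exact hu0 (by simpa using (hRu 0 h).symm)
  · rw [Finset.sum_union hPQR, Finset.sum_union hPQ, hPsum, hQsum, hRsum]
    exact CharTwo.add_self_eq_zero _
  · rw [Finset.sum_union hPQR, Finset.sum_union hPQ, hPinv, hQinv, hRinv, ← add_mul, ← add_mul,
      CharTwo.add_self_eq_zero, zero_mul]

/-- In characteristic two, four nonzero elements with vanishing sum and vanishing sum of inverses
cannot be distinct. -/
lemma eq_or_eq_of_sum_four_eq_zero {L : Type*} [Field L] [CharP L 2] {a b c d : L}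
    (ha : a ≠ 0) (hb : b ≠ 0) (hc : c ≠ 0) (hd : d ≠ 0)
    (hsum : a + b + c + d = 0) (hinv : a⁻¹ + b⁻¹ + c⁻¹ + d⁻¹ = 0) :
    a = b ∨ a = c ∨ a = d := by
  have h2 : (2 : L) = 0 := CharTwo.two_eq_zero
  have hd' : d = a + b + c := by linear_combination hsum - (a + b + c) * h2
  field_simp at hinv
  have : (a + b) * ((a + c) * (b + c)) = 0 := by
    subst hd'
    linear_combination hinv - (a * b * c) * h2
  rcases mul_eq_zero.1 this with h | h
  · exact .inl (CharTwo.add_eq_zero.1 h)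
  rcases mul_eq_zero.1 h with h | h
  · exact .inr (.inl (CharTwo.add_eq_zero.1 h))
  · refine .inr (.inr ?_)
    linear_combination -h - hd'

lemma six_le_card_of_sum_eq_zero {L : Type*} [Field L] [CharP L 2] {S : Finset L}
    (hS : S.Nonempty) (h0 : 0 ∉ S) (hcard : (S.card : L) = 0) (hsum : ∑ x ∈ S, x = 0)
    (hinv : ∑ x ∈ S, x⁻¹ = 0) : 6 ≤ S.card := by
  classical
  have heven : 2 ∣ S.card := (CharP.cast_eq_zero_iff L 2 _).1 hcard
  have hpos := hS.card_pos
  by_contra! hlt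
  obtain h | h : S.card = 2 ∨ S.card = 4 := by omega
  · obtain ⟨a, b, hab, rfl⟩ := Finset.card_eq_two.1 h
    rw [Finset.sum_pair hab] at hsum
    exact hab (CharTwo.add_eq_zero.1 hsum)
  · obtain ⟨a, T, haT, rfl, hT⟩ := Finset.card_eq_succ.1 h
    obtain ⟨b, c, d, hbc, hbd, hcd, rfl⟩ := Finset.card_eq_three.1 hT
    simp only [Finset.mem_insert, Finset.mem_singleton, not_or] at haT h0
    obtain ⟨hab, hac, had⟩ := haT
    have expand (f : L → L) : ∑ x ∈ ({a, b, c, d} : Finset L), f x = f a + f b + f c + f d := by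
      rw [Finset.sum_insert (by simp [*]), Finset.sum_insert (by simp [*]), Finset.sum_pair hcd]
      ring
    rw [expand] at hsum hinv
    rcases eq_or_eq_of_sum_four_eq_zero (Ne.symm h0.1) (Ne.symm h0.2.1) (Ne.symm h0.2.2.1)
      (Ne.symm h0.2.2.2) hsum hinv with h | h | h
    · exact hab h
    · exact hac h
    · exact had h

/-- For every `m ≥ 4`, the minimum distance of `Ω̄(2, m, 1)` equals `6`. -/
theorem stmt8 (m : ℕ) (hm : 4 ≤ m)
    (K L : Type) [Field K] [Fintype K] [Field L] [Fintype L] [Algebra K L]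
    (hcardK : Fintype.card K = 2) (hcardL : Fintype.card L = 2 ^ m)
    (α : L) (hα : orderOf α = 2 ^ m - 1) :
    IsLeast {w | ∃ c : Fin (2 ^ m - 1) → K,
        c ≠ 0 ∧ inOmegaBar 2 m 1 α c ∧ hwt c = w} 6 := by
  classical
  have hcharK : CharP K 2 := by
    have : Fact (Nat.Prime 2) := ⟨Nat.prime_two⟩
    exact charP_of_card_eq_prime hcardK
  have hcharL : CharP L 2 := charP_of_injective_algebraMap (algebraMap K L).injective 2
  have h16 : 2 ^ 4 ≤ 2 ^ m := Nat.pow_le_pow_right (by norm_num) hm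
  have hα0 : α ≠ 0 := by
    rintro rfl
    rw [orderOf_zero] at hα
    omega
  have hinj : Function.Injective (fun i : Fin (2 ^ m - 1) => α ^ (i : ℕ)) := fun i j hij =>
    Fin.ext (pow_injOn_Iio_orderOf (by simp [hα]) (by simp [hα]) hij)
  constructor
  · obtain ⟨S, hS6, hS0, hsum, hinv⟩ := exists_card_six_sum_eq_zero (L := L) (by omega)
    have himage : Finset.univ.image (fun i : Fin (2 ^ m - 1) => α ^ (i : ℕ)) =
        Finset.univ.erase 0 := by
      apply Finset.eq_of_subset_of_card_le
      · intro x hx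
        obtain ⟨i, -, rfl⟩ := Finset.mem_image.1 hx
        simp [hα0]
      · rw [Finset.card_image_of_injective _ hinj, Finset.card_erase_of_mem (Finset.mem_univ _)]
        simp [hcardL]
    set T := Finset.univ.filter (fun i : Fin (2 ^ m - 1) => α ^ (i : ℕ) ∈ S) with hT
    have hTS : T.image (fun i : Fin (2 ^ m - 1) => α ^ (i : ℕ)) = S := by
      ext x
      simp only [hT, Finset.mem_image, Finset.mem_filter, Finset.mem_univ, true_and]
      constructor
      · rintro ⟨i, hi, rfl⟩
        exact hi
      · intro hx
        have : x ∈ Finset.univ.image (fun i : Fin (2 ^ m - 1) => α ^ (i : ℕ)) := by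
          rw [himage]
          simpa using fun h : x = 0 => hS0 (h ▸ hx)
        obtain ⟨i, -, rfl⟩ := Finset.mem_image.1 this
        exact ⟨i, hx, rfl⟩
    have hTcard : T.card = 6 := by
      rw [← hS6, ← hTS, Finset.card_image_of_injective _ hinj]
    have key (g : L → L) : ∑ i : Fin (2 ^ m - 1),
        algebraMap K L (if i ∈ T then 1 else 0) * g (α ^ (i : ℕ)) = ∑ x ∈ S, g x := by
      rw [← hTS, Finset.sum_image (fun _ _ _ _ h => hinj h)]
      simp [apply_ite (algebraMap K L), Finset.sum_ite_mem]
    have hwt6 : hwt (fun i => if i ∈ T then (1 : K) else 0) = 6 := by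
      rw [← hTcard, ← Set.ncard_coe_finset]
      unfold hwt
      congr 1
      ext i
      simp
    refine ⟨fun i => if i ∈ T then 1 else 0, ?_, ⟨?_, ?_⟩, hwt6⟩
    · intro h
      rw [h] at hwt6
      simp [hwt] at hwt6
    · have := key (fun _ => 1)
      simp only [mul_one] at this
      rw [this, Finset.sum_const, hS6, nsmul_one]
      exact (CharP.cast_eq_zero_iff L 2 6).2 (by norm_num)
    · rintro a ⟨ha1, -, haw⟩
      obtain ⟨j, rfl⟩ := exists_eq_two_pow_of_wtq_le_one a ha1 haw
      constructor
      · have := key (fun x => x ^ 2 ^ j)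
        rw [← sum_pow_char_pow, hsum, zero_pow (by positivity)] at this
        simpa only [← pow_mul, mul_comm (2 ^ j)] using this
      · have := key (fun x => x⁻¹ ^ 2 ^ j)
        rw [← sum_pow_char_pow, hinv, zero_pow (by positivity)] at this
        simpa only [← inv_pow, ← pow_mul, mul_comm (2 ^ j)] using this
  · rintro w ⟨c, hc0, ⟨hone, hpow⟩, rfl⟩
    have hK (x : K) : x = 0 ∨ x = 1 := by
      by_contra! h
      have : ({0, 1, x} : Finset K).card ≤ 2 := hcardK ▸ Finset.card_le_univ _
      rw [Finset.card_eq_three.2 ⟨0, 1, x, zero_ne_one, h.1.symm, h.2.symm, rfl⟩] at this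
      omega
    set T := Finset.univ.filter (fun i => c i ≠ 0) with hT
    have hwtT : hwt c = T.card := by
      rw [← Set.ncard_coe_finset]
      simp [hwt, hT]
    set S := T.image (fun i : Fin (2 ^ m - 1) => α ^ (i : ℕ)) with hS
    have hcardS : S.card = T.card := Finset.card_image_of_injective _ hinj
    have key (g : L → L) : ∑ i : Fin (2 ^ m - 1), algebraMap K L (c i) * g (α ^ (i : ℕ)) =
        ∑ x ∈ S, g x := by
      rw [hS, Finset.sum_image (fun _ _ _ _ h => hinj h), hT, Finset.sum_filter]
      refine Finset.sum_congr rfl fun i _ => ?_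
      rcases hK (c i) with h | h <;> simp [h]
    obtain ⟨h1, h2⟩ := hpow 1 (one_mem_Iset hm)
    rw [hwtT, ← hcardS]
    apply six_le_card_of_sum_eq_zero (L := L)
    · obtain ⟨i, hi⟩ := Function.ne_iff.1 hc0
      exact ⟨α ^ (i : ℕ), Finset.mem_image.2 ⟨i, by simpa [hT] using hi, rfl⟩⟩
    · simp [hS, hα0]
    · have := key (fun _ => 1)
      simp only [mul_one] at this
      rw [hone] at this
      simpa using this.symm
    · rw [← key (fun x => x)]
      simpa using h1
    · rw [← key (fun x => x⁻¹)]
      simpa using h2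
end

section
/- For every prime power q ≥ 3, there exists a constant c = c(q) > 0 such that for every odd integer m > c, the minimum distance satisfies d̄(q, m, 1) ≤ 2(2q − 1). -/
/-- A positive number of base-`q` weight at most one is either less than `q`, or `q` times a
smaller positive number of weight at most one. -/
lemma lt_or_eq_mul_of_wtq_le_one {q a : ℕ} (hq : 2 ≤ q) (ha : 1 ≤ a) (hw : wtq q a ≤ 1) :
    a < q ∨ ∃ b, a = q * b ∧ 1 ≤ b ∧ b < a ∧ wtq q b ≤ 1 := by
  have hdig : Nat.digits q a = (a % q) :: Nat.digits q (a / q) :=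
    Nat.digits_def' (by omega) (by omega)
  have hdiv := Nat.div_add_mod a q
  by_cases h0 : a % q = 0
  · right
    have hb : 1 ≤ a / q := by
      by_contra! h
      have : a / q = 0 := Nat.lt_one_iff.mp h
      rw [this, h0] at hdiv
      omega
    refine ⟨a / q, by omega, hb, Nat.div_lt_self (by omega) (by omega), ?_⟩
    simpa [wtq, hdig, h0] using hw
  · left
    by_contra! h
    have hne : a / q ≠ 0 := (Nat.div_pos h (by omega)).ne'
    have hnil : (Nat.digits q (a / q)).filter (fun d => d ≠ 0) = [] := by
      rw [← List.length_eq_zero_iff]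
      rw [wtq, hdig, List.filter_cons_of_pos (by simpa using h0), List.length_cons] at hw
      omega
    rw [List.filter_eq_nil_iff] at hnil
    exact hnil _ (List.getLast_mem (Nat.digits_ne_nil_iff_ne_zero.mpr hne))
      (by simpa using Nat.getLast_digit_ne_zero q hne)

/-- If the coefficients lie in `F_q` and the power sums with exponents `1, …, q - 1` vanish, so
do all power sums whose exponent has weight one. -/
lemma sum_mul_pow_eq_zero_of_wtq_le_one {K L ι : Type*} [Field K] [Fintype K] [Field L]
    [Algebra K L] [Fintype ι] {q : ℕ} (hq : 2 ≤ q) (hK : Fintype.card K = q)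
    (c : ι → K) (x : ι → L)
    (h : ∀ d, 1 ≤ d → d < q → ∑ i, algebraMap K L (c i) * x i ^ d = 0) (a : ℕ) :
    1 ≤ a → wtq q a ≤ 1 → ∑ i, algebraMap K L (c i) * x i ^ a = 0 := by
  induction a using Nat.strong_induction_on with
  | _ a ih =>
    intro ha hw
    obtain hlt | ⟨b, hab, hb, hba, hwb⟩ := lt_or_eq_mul_of_wtq_le_one hq ha hw
    · exact h a ha hlt
    · have := congrArg (FiniteField.frobeniusAlgHom K L) (ih b hba hb hwb)
      simpa only [map_sum, map_mul, map_zero, AlgHom.commutes, FiniteField.coe_frobeniusAlgHom,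
        hK, ← pow_mul, mul_comm b q, ← hab] using this

lemma pow_pred_lt_choose_pred {Q k : ℕ} (hk : 1 ≤ k) (hQ : 2 ^ k * k.factorial + 2 * k < Q) :
    Q ^ (k - 1) < (Q - 1).choose k := by
  have h1 : Q ^ k ≤ 2 ^ k * (Q - k) ^ k := by
    rw [← mul_pow]
    exact Nat.pow_le_pow_left (by omega) k
  have h2 : (Q - k) ^ k ≤ k.factorial * (Q - 1).choose k := by
    rw [← Nat.descFactorial_eq_factorial_mul_choose]
    convert Nat.pow_sub_le_descFactorial (Q - 1) k using 2
    omega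
  have h3 : 2 ^ k * k.factorial * Q ^ (k - 1) < Q ^ k := by
    obtain ⟨j, rfl⟩ : ∃ j, k = j + 1 := ⟨k - 1, by omega⟩
    rw [Nat.add_sub_cancel, pow_succ Q, mul_comm (Q ^ j)]
    exact Nat.mul_lt_mul_of_pos_right (by omega) (Nat.pow_pos (by omega))
  have h4 : 2 ^ k * k.factorial * Q ^ (k - 1) <
      2 ^ k * k.factorial * (Q - 1).choose k := by
    calc _ < _ := h3
      _ ≤ _ := h1
      _ ≤ 2 ^ k * (k.factorial * (Q - 1).choose k) := Nat.mul_le_mul_left _ h2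
      _ = _ := by ring
  exact lt_of_mul_lt_mul_left h4 (Nat.zero_le _)

/-- Pigeonhole: among the `k`-subsets of `Fin n`, two have the same values of any statistic
with fewer than `n.choose k` values. -/
lemma exists_ne_card_eq_of_card_lt_choose {β : Type*} [Fintype β] {n k : ℕ}
    (f : Finset (Fin n) → β) (h : Fintype.card β < n.choose k) :
    ∃ S T : Finset (Fin n), S ≠ T ∧ S.card = k ∧ T.card = k ∧ f S = f T := by
  classical
  obtain ⟨S, hS, T, hT, hne, hf⟩ := Finset.exists_ne_map_eq_of_card_lt_of_maps_to
    (s := (Finset.univ : Finset (Fin n)).powersetCard k) (t := (Finset.univ : Finset β))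
    (by simpa using h) (fun S _ => Finset.mem_coe.mpr (Finset.mem_univ (f S)))
  exact ⟨S, T, hne, (Finset.mem_powersetCard.mp hS).2, (Finset.mem_powersetCard.mp hT).2, hf⟩

/-- For every prime power `q ≥ 3` there is a constant `c > 0` such that for
every odd `m > c`, the minimum distance of `Ω̄(q, m, 1)` is at most `2(2q - 1)`, i.e.
there is a nonzero codeword of Hamming weight at most `2(2q - 1)`. -/
theorem stmt10 (q : ℕ) (hq : IsPrimePow q) (hq3 : 3 ≤ q) :
    ∃ c : ℕ, 0 < c ∧ ∀ m : ℕ, Odd m → c < m →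
      ∀ (K L : Type) [Field K] [Fintype K] [Field L] [Fintype L] [Algebra K L],
        Fintype.card K = q → Fintype.card L = q ^ m →
        ∀ α : L, orderOf α = q ^ m - 1 →
          ∃ co : Fin (q ^ m - 1) → K,
            co ≠ 0 ∧ inOmegaBar q m 1 α co ∧ hwt co ≤ 2 * (2 * q - 1) := by
  set k := 2 * q - 1 with hk
  refine ⟨2 ^ k * k.factorial + 2 * k, by omega, ?_⟩
  intro m _ hm K L _ _ _ _ _ hK hL α _
  classical
  have hlarge : 2 ^ k * k.factorial + 2 * k < q ^ m :=
    hm.trans (Nat.lt_pow_self (by omega))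
  obtain ⟨S, T, hne, hS, hT, hf⟩ := exists_ne_card_eq_of_card_lt_choose (k := k)
    (fun (S : Finset (Fin (q ^ m - 1))) (d : Fin (q - 1)) =>
      (∑ i ∈ S, (α ^ (i : ℕ)) ^ ((d : ℕ) + 1), ∑ i ∈ S, (α⁻¹ ^ (i : ℕ)) ^ ((d : ℕ) + 1)))
    (by
      have := pow_pred_lt_choose_pred (by omega) hlarge
      rw [Fintype.card_fun, Fintype.card_prod, hL, Fintype.card_fin, ← pow_two, ← pow_mul]
      rwa [show k - 1 = 2 * (q - 1) by omega] at this)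
  let co : Fin (q ^ m - 1) → K := fun i => (if i ∈ S then 1 else 0) - (if i ∈ T then 1 else 0)
  have hsum : ∀ y : Fin (q ^ m - 1) → L,
      ∑ i, algebraMap K L (co i) * y i = ∑ i ∈ S, y i - ∑ i ∈ T, y i := by
    intro y
    simp [co, sub_mul, Finset.sum_sub_distrib, apply_ite (algebraMap K L)]
  refine ⟨co, ?_, ⟨?_, ?_⟩, ?_⟩
  · intro h0
    refine hne (Finset.ext fun i => ?_)
    have hi := congrFun h0 i
    by_cases h1 : i ∈ S <;> by_cases h2 : i ∈ T <;> simp [co, h1, h2] at hi ⊢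
  · simpa [hS, hT] using hsum (fun _ => 1)
  · rintro a ⟨ha, -, hw⟩
    have hd : ∀ d, 1 ≤ d → d < q →
        ∑ i ∈ S, (α ^ (i : ℕ)) ^ d = ∑ i ∈ T, (α ^ (i : ℕ)) ^ d ∧
        ∑ i ∈ S, (α⁻¹ ^ (i : ℕ)) ^ d = ∑ i ∈ T, (α⁻¹ ^ (i : ℕ)) ^ d := by
      intro d hd1 hdq
      have := congrFun hf ⟨d - 1, by omega⟩
      simpa only [Nat.sub_add_cancel hd1, Prod.mk.injEq] using this
    simp only [mul_comm a, pow_mul]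
    exact ⟨sum_mul_pow_eq_zero_of_wtq_le_one (by omega) hK co _
        (fun d h1 h2 => by rw [hsum, (hd d h1 h2).1, sub_self]) a ha hw,
      sum_mul_pow_eq_zero_of_wtq_le_one (by omega) hK co _
        (fun d h1 h2 => by rw [hsum, (hd d h1 h2).2, sub_self]) a ha hw⟩
  · have hsub : {i | co i ≠ 0} ⊆ ((S ∪ T : Finset (Fin (q ^ m - 1))) : Set _) := by
      intro i hi
      by_contra h
      simp only [Finset.coe_union, Set.mem_union, Finset.mem_coe, not_or] at h
      exact hi (by simp [co, h.1, h.2])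
    calc hwt co ≤ (S ∪ T).card := by
          simpa only [hwt, Set.ncard_coe_finset] using Set.ncard_le_ncard hsub (Finset.finite_toSet _)
      _ ≤ S.card + T.card := Finset.card_union_le S T
      _ = 2 * k := by omega
end

section
/- For every odd integer m ≥ 3, with n = 3^m − 1, there is no F_3-linear subspace C of F_3^n of dimension n − 1 − 4m such that every nonzero vector of C has Hamming weight at least 11. -/
/-- The ternary vector equal to `1` on `T`, to `-1` on `S \ T` and to `0` elsewhere. -/
def signVector {n : ℕ} (S T : Finset (Fin n)) : Fin n → ZMod 3 :=
  fun i => if i ∈ T then 1 else if i ∈ S then -1 else 0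

theorem signVector_ne_zero_iff {n : ℕ} {S T : Finset (Fin n)} (h : T ⊆ S) (i : Fin n) :
    signVector S T i ≠ 0 ↔ i ∈ S := by
  unfold signVector
  by_cases hT : i ∈ T
  · simp [hT, h hT]
  · by_cases hS : i ∈ S <;> simp [hT, hS]

theorem signVector_eq_one_iff {n : ℕ} (S T : Finset (Fin n)) (i : Fin n) :
    signVector S T i = 1 ↔ i ∈ T := by
  unfold signVector
  have h : (-1 : ZMod 3) ≠ 1 := by decide
  by_cases hT : i ∈ T
  · simp [hT]
  · by_cases hS : i ∈ S <;> simp [hT, hS, h]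

theorem hwt_signVector_sub_le {n : ℕ} {S T S' T' : Finset (Fin n)} (h : T ⊆ S) (h' : T' ⊆ S') :
    hwt (signVector S T - signVector S' T') ≤ S.card + S'.card := by
  classical
  refine le_trans ?_ (Finset.card_union_le S S')
  rw [← Set.ncard_coe_finset]
  refine Set.ncard_le_ncard (fun i hi => ?_) (Finset.finite_toSet _)
  by_contra hn
  simp only [Finset.coe_union, Set.mem_union, Finset.mem_coe, not_or] at hn
  rw [← signVector_ne_zero_iff h, ← signVector_ne_zero_iff h', not_not, not_not] at hn
  exact hi (by simp [hn.1, hn.2])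

/-- A sphere-packing bound for ternary linear codes, counting only the vectors of weight `t`. -/
theorem choose_mul_two_pow_le_of_lt_hwt {n t : ℕ} (C : Submodule (ZMod 3) (Fin n → ZMod 3))
    (hC : ∀ v ∈ C, v ≠ 0 → 2 * t < hwt v) :
    n.choose t * 2 ^ t ≤ 3 ^ (n - Module.finrank (ZMod 3) C) := by
  classical
  have : Fact (Nat.Prime 3) := ⟨Nat.prime_three⟩
  let A : Finset (Σ _ : Finset (Fin n), Finset (Fin n)) :=
    (Finset.powersetCard t Finset.univ).sigma fun S => S.powerset
  have hA : A.card = n.choose t * 2 ^ t := by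
    rw [Finset.card_sigma, Finset.sum_congr rfl (g := fun _ => 2 ^ t)]
    · simp
    · intro S hS
      rw [Finset.card_powerset, (Finset.mem_powersetCard.1 hS).2]
  have hq : Nat.card ((Fin n → ZMod 3) ⧸ C) = 3 ^ (n - Module.finrank (ZMod 3) C) := by
    rw [Module.natCard_eq_pow_finrank (K := ZMod 3), Nat.card_zmod, Submodule.finrank_quotient,
      Module.finrank_fin_fun]
  have : Fintype ((Fin n → ZMod 3) ⧸ C) := Fintype.ofFinite _
  rw [← hA, ← hq, Nat.card_eq_fintype_card, ← Finset.card_univ]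
  refine Finset.card_le_card_of_injOn (fun p => C.mkQ (signVector p.1 p.2)) (by simp) ?_
  rintro ⟨S, T⟩ h ⟨S', T'⟩ h' heq
  simp only [A, Finset.coe_sigma, Set.mem_sigma_iff, Finset.mem_coe, Finset.mem_powersetCard,
    Finset.mem_powerset, Finset.subset_univ, true_and] at h h'
  have hmem : signVector S T - signVector S' T' ∈ C := (Submodule.Quotient.eq C).1 heq
  have hv : signVector S T = signVector S' T' := by
    by_contra hne
    have h1 := hC _ hmem (sub_ne_zero.2 hne)
    have h2 := hwt_signVector_sub_le h.2 h'.2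
    omega
  have hS : S = S' := by
    ext i
    rw [← signVector_ne_zero_iff h.2, hv, signVector_ne_zero_iff h'.2]
  have hT : T = T' := by
    ext i
    rw [← signVector_eq_one_iff S, hv, signVector_eq_one_iff]
  rw [hS, hT]

theorem three_mul_pow_four_lt_choose_five {n : ℕ} (hn : 26 ≤ n) :
    3 * (n + 1) ^ 4 < n.choose 5 * 2 ^ 5 := by
  obtain ⟨k, rfl⟩ := Nat.exists_eq_add_of_le' hn
  have h := Nat.descFactorial_eq_factorial_mul_choose (k + 26) 5
  simp only [Nat.descFactorial, Nat.factorial, Nat.reduceSubDiff, Nat.sub_zero] at h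
  ring_nf at h ⊢
  nlinarith [Nat.zero_le (k ^ 2), Nat.zero_le (k ^ 3), Nat.zero_le (k ^ 4), Nat.zero_le (k ^ 5)]

/-- For odd `m ≥ 3` and `n = 3^m - 1`, there is no `F_3`-linear subspace of
`F_3^n` of dimension `n - 1 - 4m` in which every nonzero vector has Hamming weight
at least `11`. -/
theorem stmt12 (m : ℕ) (hm : 3 ≤ m) (hmo : Odd m) :
    ¬ ∃ C : Submodule (ZMod 3) (Fin (3 ^ m - 1) → ZMod 3),
      Module.finrank (ZMod 3) C = 3 ^ m - 1 - 1 - 4 * m ∧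
      ∀ v ∈ C, v ≠ 0 → 11 ≤ hwt v := by
  rintro ⟨C, hdim, hC⟩
  have hpow : 3 ^ 3 ≤ 3 ^ m := Nat.pow_le_pow_right (by norm_num) hm
  have hle := choose_mul_two_pow_le_of_lt_hwt (t := 5) C hC
  have hlt := three_mul_pow_four_lt_choose_five (n := 3 ^ m - 1) (by omega)
  have hexp : 3 ^ (3 ^ m - 1 - Module.finrank (ZMod 3) C) ≤ 3 ^ (4 * m + 1) :=
    Nat.pow_le_pow_right (by norm_num) (by omega)
  have heq : 3 * (3 ^ m - 1 + 1) ^ 4 = 3 ^ (4 * m + 1) := by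
    rw [Nat.sub_add_cancel (by omega)]
    ring
  omega
end

section
/- Let q be a prime power and a an integer with 1 ≤ a ≤ q − 2 and gcd(a, q) = 1, and set e = q + a. Suppose the multiplicative order l of (−a) modulo e is odd. Then for every odd integer λ ≥ 1 with λ·l ≥ 2, the minimum distance satisfies d(q, λ·l, 1) ≤ e. -/
/-- A positive integer of base-`q` weight at most one is not divisible by any `e > q - 1`
coprime to `q`. -/
theorem not_dvd_of_wtq_le_one {q e : ℕ} (hq : 1 < q) (hqe : q ≤ e) (hcop : Nat.Coprime e q)
    {b : ℕ} (hb : 0 < b) (hwt : wtq q b ≤ 1) : ¬ e ∣ b := by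
  induction b using Nat.strong_induction_on with
  | _ b ih =>
    rw [wtq, Nat.digits_def' hq hb] at hwt
    by_cases h0 : b % q = 0
    · have hb' : b = q * (b / q) := (Nat.mul_div_cancel' (Nat.dvd_of_mod_eq_zero h0)).symm
      have hpos : 0 < b / q := Nat.pos_of_ne_zero fun h => by rw [h] at hb'; omega
      intro hdvd
      rw [hb'] at hdvd
      exact ih (b / q) (Nat.div_lt_self hb hq) hpos (by simpa [wtq, h0] using hwt)
        (hcop.dvd_of_dvd_mul_left hdvd)
    · have hnil : (Nat.digits q (b / q)).filter (fun d => d ≠ 0) = [] := by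
        simpa [h0] using hwt
      have hdiv : b / q = 0 := by
        by_contra hne
        have hne' := Nat.digits_ne_nil_iff_ne_zero (b := q).mpr hne
        have := List.filter_eq_nil_iff.mp hnil _ (List.getLast_mem hne')
        exact this (by simpa using Nat.getLast_digit_ne_zero q hne)
      have hlt : b < q := (Nat.div_eq_zero_iff_lt (by omega)).mp hdiv
      exact fun hdvd => absurd (Nat.le_of_dvd hb hdvd) (by omega)

/-- If `e` divides `q ^ m - 1` and `q ≤ e`, then the indicator of the `e`-th roots of unity is a
codeword of `Ω(q,m,1)`. -/
theorem exists_inOmega_one_of_dvd {K L : Type*} [Field K] [Field L] [Algebra K L]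
    {q m e : ℕ} (hq : 1 < q) (hm : m ≠ 0) (hqe : q ≤ e) (he : e ∣ q ^ m - 1)
    {α : L} (hα : orderOf α = q ^ m - 1) :
    ∃ c : Fin (q ^ m - 1) → K, c ≠ 0 ∧ inOmega q m 1 α c ∧ hwt c ≤ e := by
  classical
  have hqm : 1 < q ^ m := Nat.one_lt_pow hm hq
  obtain ⟨d, hd⟩ := he
  have hdpos : 0 < d := Nat.pos_of_ne_zero fun h => by rw [h] at hd; omega
  have hcop : Nat.Coprime e q := by
    have h1 : Nat.Coprime (q ^ m - 1) (q ^ m) :=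
      (Nat.coprime_self_sub_left hqm.le).mpr (Nat.coprime_one_left _)
    exact (h1.coprime_dvd_left ⟨d, hd⟩).coprime_dvd_right (dvd_pow_self q hm)
  let f : Fin e → Fin (q ^ m - 1) := fun t =>
    ⟨d * t, by rw [hd, mul_comm e]; exact Nat.mul_lt_mul_of_pos_left t.2 hdpos⟩
  have hf : Function.Injective f := fun s t h =>
    Fin.ext (Nat.eq_of_mul_eq_mul_left hdpos (congrArg Fin.val h))
  refine ⟨fun i => if i ∈ Finset.univ.image f then 1 else 0, ?_, ?_, ?_⟩
  · intro h
    simpa using congrFun h (f ⟨0, by omega⟩)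
  · intro b hb
    have hω : α ^ (b * d) ≠ 1 := by
      rw [Ne, ← orderOf_dvd_iff_pow_eq_one, hα, hd, Nat.mul_dvd_mul_iff_right hdpos]
      exact not_dvd_of_wtq_le_one hq hqe hcop hb.1 hb.2.2
    have hωe : (α ^ (b * d)) ^ e = 1 := by
      rw [← pow_mul, ← orderOf_dvd_iff_pow_eq_one, hα, hd]
      exact ⟨b, by ring⟩
    calc _ = ∑ i ∈ Finset.univ.image f, α ^ (b * (i : ℕ)) := by
            simp [apply_ite, ite_mul, Finset.sum_ite]
      _ = ∑ t : Fin e, (α ^ (b * d)) ^ (t : ℕ) := by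
            rw [Finset.sum_image fun _ _ _ _ h => hf h]
            exact Finset.sum_congr rfl fun t _ => by rw [← pow_mul, mul_assoc]
      _ = 0 := by
            rw [Fin.sum_univ_eq_sum_range (fun t => (α ^ (b * d)) ^ t) e, geom_sum_eq hω, hωe,
              sub_self, zero_div]
  · have hsupp : {i | (if i ∈ Finset.univ.image f then (1 : K) else 0) ≠ 0} =
        (Finset.univ.image f : Set (Fin (q ^ m - 1))) := by
      ext i
      simp
    rw [hwt, hsupp, Set.ncard_coe_finset]
    exact Finset.card_image_le.trans (by simp)

/-- Let `q` be a prime power, `1 ≤ a ≤ q - 2` with `gcd(a, q) = 1`, and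
`e = q + a`. If the multiplicative order `l` of `-a` modulo `e` is odd, then for every odd
`λ ≥ 1` (with `λ·l ≥ 2`) the minimum distance of `Ω(q, λ·l, 1)` is at most `e`, i.e.
there is a nonzero codeword of Hamming weight at most `e`. -/
theorem stmt13 (q a : ℕ) (hq : IsPrimePow q) (ha1 : 1 ≤ a) (ha2 : a ≤ q - 2)
    (hgcd : Nat.gcd a q = 1)
    (l : ℕ) (hl : l = orderOf (-(a : ZMod (q + a)))) (hlodd : Odd l)
    (lam : ℕ) (hlam1 : 1 ≤ lam) (hlamodd : Odd lam) (hm : 2 ≤ lam * l)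
    (K L : Type) [Field K] [Fintype K] [Field L] [Fintype L] [Algebra K L]
    (hcardK : Fintype.card K = q) (hcardL : Fintype.card L = q ^ (lam * l))
    (α : L) (hα : orderOf α = q ^ (lam * l) - 1) :
    ∃ c : Fin (q ^ (lam * l) - 1) → K,
      c ≠ 0 ∧ inOmega q (lam * l) 1 α c ∧ hwt c ≤ q + a := by
  have hdvd : q + a ∣ q ^ (lam * l) - 1 := by
    rw [← ZMod.natCast_eq_zero_iff, Nat.cast_sub (Nat.one_le_pow _ _ (by omega))]
    have hqa : (q : ZMod (q + a)) = -(a : ZMod (q + a)) :=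
      eq_neg_of_add_eq_zero_left (by exact_mod_cast ZMod.natCast_self (q + a))
    rw [Nat.cast_pow, hqa, mul_comm lam l, pow_mul, hl, pow_orderOf_eq_one]
    simp
  exact exists_inOmega_one_of_dvd (by omega) (by omega) (by omega) hdvd hα
end

section
/- Let q be a prime power and m ≥ 3 an odd integer. If e is a divisor of n = q^m − 1 with q + 1 ≤ e ≤ 2q − 1, then the minimum distances satisfy d(q, m, 1) ≤ e and d̄(q, m, 1) ≤ 2e. -/
theorem not_dvd_of_wtq_le_one_s15 {q e a : ℕ} (hq : 2 ≤ q) (hqe : q ≤ e) (hcop : e.Coprime q)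
    (ha : 1 ≤ a) (hw : wtq q a ≤ 1) : ¬ e ∣ a := by
  induction a using Nat.strong_induction_on with
  | _ a ih =>
    have hdig : Nat.digits q a = (a % q) :: Nat.digits q (a / q) :=
      Nat.digits_def' (by omega) ha
    have hdecomp := Nat.div_add_mod a q
    by_cases hr : a % q = 0
    · have hw' : wtq q (a / q) ≤ 1 := by simpa [wtq, hdig, hr] using hw
      rw [hr, add_zero] at hdecomp
      have hpos : 1 ≤ a / q := by
        by_contra hlt
        rw [Nat.lt_one_iff.1 (not_le.1 hlt)] at hdecomp
        omega
      intro hd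
      rw [← hdecomp] at hd
      exact ih _ (Nat.div_lt_self ha hq) hpos hw' (hcop.dvd_of_dvd_mul_left hd)
    · have hz : a / q = 0 := by
        by_contra hne
        have hmem := Nat.getLast_digit_ne_zero q hne
        have hnil : Nat.digits q (a / q) ≠ [] := Nat.digits_ne_nil_iff_ne_zero.2 hne
        have hempty : ∀ d ∈ Nat.digits q (a / q), d = 0 := by
          simpa [wtq, hdig, hr, List.filter_eq_nil_iff] using hw
        exact hmem (hempty _ (List.getLast_mem hnil))
      intro hd
      have := Nat.le_of_dvd ha hd
      have := Nat.mod_lt a (show q > 0 by omega)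
      rw [hz, mul_zero] at hdecomp
      omega

theorem sum_range_mul_mod_mul_pow {R : Type*} [CommSemiring R] (k e : ℕ) (f : ℕ → R) (z : R) :
    ∑ i ∈ Finset.range (k * e), f (i % k) * z ^ i =
      (∑ j ∈ Finset.range e, (z ^ k) ^ j) * ∑ r ∈ Finset.range k, f r * z ^ r := by
  induction e with
  | zero => simp
  | succ e ih =>
    rw [Nat.mul_succ, Finset.sum_range_add, ih, Finset.sum_range_succ, add_mul,
      Finset.mul_sum _ _ ((z ^ k) ^ e)]
    congr 1
    refine Finset.sum_congr rfl fun r hr => ?_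
    rw [Nat.mul_add_mod, Nat.mod_eq_of_lt (Finset.mem_range.1 hr), pow_add, pow_mul]
    ring

theorem sum_range_pow_eq_zero {L : Type*} [Field L] {w : L} {e : ℕ} (hw : w ≠ 1)
    (he : w ^ e = 1) : ∑ j ∈ Finset.range e, w ^ j = 0 := by
  rw [geom_sum_eq hw, he, sub_self, zero_div]

theorem hwt_mod_le {R : Type*} [Zero R] {n k e : ℕ} (hn : n = k * e) (g : ℕ → R) (s : Finset ℕ)
    (hs : ∀ r, r ∉ s → g r = 0) : hwt (fun i : Fin n => g (i % k)) ≤ s.card * e := by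
  classical
  subst hn
  have hmaps : ∀ i ∈ {i : Fin (k * e) | g (i % k) ≠ 0},
      ((i : ℕ) % k, (i : ℕ) / k) ∈ (↑(s ×ˢ Finset.range e) : Set (ℕ × ℕ)) := by
    intro i hi
    simp only [Finset.coe_product, Set.mem_prod, Finset.mem_coe, Finset.mem_range]
    exact ⟨by_contra fun h => hi (hs _ h), Nat.div_lt_of_lt_mul i.2⟩
  have hinj : Set.InjOn (fun i : Fin (k * e) => ((i : ℕ) % k, (i : ℕ) / k))
      {i : Fin (k * e) | g (i % k) ≠ 0} := by
    intro i _ j _ hij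
    obtain ⟨h₁, h₂⟩ := Prod.mk.inj hij
    apply Fin.ext
    rw [← Nat.div_add_mod (i : ℕ) k, ← Nat.div_add_mod (j : ℕ) k, h₁, h₂]
  have hle := Set.ncard_le_ncard_of_injOn _ hmaps hinj (Finset.finite_toSet _)
  rwa [Set.ncard_coe_finset, Finset.card_product, Finset.card_range] at hle

theorem sum_fin_mod_mul_pow {K L : Type*} [Field K] [Field L] [Algebra K L] {n k e : ℕ}
    (hn : n = k * e) (g : ℕ → K) (z : L) :
    ∑ i : Fin n, algebraMap K L (g (i % k)) * z ^ (i : ℕ) =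
      (∑ j ∈ Finset.range e, (z ^ k) ^ j) *
        ∑ r ∈ Finset.range k, algebraMap K L (g r) * z ^ r := by
  subst hn
  rw [← sum_range_mul_mod_mul_pow k e (fun r => algebraMap K L (g r)) z,
    Finset.sum_range]

/-- For a prime power `q`, odd `m ≥ 3`, and a divisor `e` of `q^m - 1` with
`q + 1 ≤ e ≤ 2q - 1`, the minimum distance of `Ω(q, m, 1)` is at most `e` and that of
`Ω̄(q, m, 1)` is at most `2e`. -/
theorem stmt15 (q m e : ℕ) (hq : IsPrimePow q) (hm : 3 ≤ m) (hmo : Odd m)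
    (hdvd : e ∣ q ^ m - 1) (he1 : q + 1 ≤ e) (he2 : e ≤ 2 * q - 1)
    (K L : Type) [Field K] [Fintype K] [Field L] [Fintype L] [Algebra K L]
    (hcardK : Fintype.card K = q) (hcardL : Fintype.card L = q ^ m)
    (α : L) (hα : orderOf α = q ^ m - 1) :
    (∃ c : Fin (q ^ m - 1) → K, c ≠ 0 ∧ inOmega q m 1 α c ∧ hwt c ≤ e) ∧
    (∃ c : Fin (q ^ m - 1) → K, c ≠ 0 ∧ inOmegaBar q m 1 α c ∧ hwt c ≤ 2 * e) := by
  have hq2 : 2 ≤ q := hq.two_le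
  obtain ⟨k, hk⟩ := hdvd
  have hn : q ^ m - 1 = k * e := by rw [hk, mul_comm]
  have hlt : 2 * q - 1 < q ^ m - 1 := by
    have h₁ : q ^ 3 ≤ q ^ m := Nat.pow_le_pow_right (by omega) hm
    have h₂ : 4 * q ≤ q ^ 3 := by nlinarith [Nat.mul_le_mul hq2 hq2]
    omega
  have hk2 : 2 ≤ k := by
    by_contra hk2
    have : k * e ≤ 1 * e := Nat.mul_le_mul_right e (by omega)
    omega
  have hcop : e.Coprime q := by
    have h₁ : (q ^ m - 1).Coprime (q ^ m) :=
      (Nat.coprime_self_sub_left (Nat.one_le_pow _ _ (by omega))).2 (Nat.coprime_one_left _)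
    exact (h₁.coprime_dvd_left ⟨k, hk⟩).coprime_dvd_right (dvd_pow_self q (by omega))
  have hroot : ∀ β : L, orderOf β = q ^ m - 1 → ∀ a ∈ Iset q m 1,
      ∑ j ∈ Finset.range e, ((β ^ a) ^ k) ^ j = 0 := by
    intro β hβ a ha
    apply sum_range_pow_eq_zero
    · rw [← pow_mul, Ne, ← orderOf_dvd_iff_pow_eq_one, hβ, hk,
        Nat.mul_dvd_mul_iff_right (by omega)]
      exact not_dvd_of_wtq_le_one_s15 hq2 (by omega) hcop ha.1 ha.2.2
    · rw [← pow_mul, ← hn, ← pow_mul, mul_comm, pow_mul, ← hβ, pow_orderOf_eq_one, one_pow]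
  have hmem : ∀ (g : ℕ → K) (β : L), orderOf β = q ^ m - 1 → ∀ a ∈ Iset q m 1,
      ∑ i : Fin (q ^ m - 1), algebraMap K L (g (i % k)) * β ^ (a * (i : ℕ)) = 0 := by
    intro g β hβ a ha
    simp_rw [pow_mul]
    rw [sum_fin_mod_mul_pow hn, hroot β hβ a ha, zero_mul]
  have hα' : orderOf α⁻¹ = q ^ m - 1 := by
    rw [← hα]
    exact orderOf_eq_orderOf_iff.2 fun j => by rw [inv_pow, inv_eq_one]
  have hne : ∀ g : ℕ → K, g 0 = 1 → (fun i : Fin (q ^ m - 1) => g (i % k)) ≠ 0 := by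
    intro g hg h
    simpa [hg] using congrFun h ⟨0, by omega⟩
  constructor
  · refine ⟨fun i => (Pi.single 0 1 : ℕ → K) (i % k), hne _ (by simp), hmem _ α hα, ?_⟩
    have := hwt_mod_le hn (Pi.single 0 1 : ℕ → K) {0} fun r hr => by
      rw [Pi.single_eq_of_ne (by simpa using hr)]
    simpa using this
  · refine ⟨fun i => (Pi.single 0 1 - Pi.single 1 1 : ℕ → K) (i % k), hne _ (by simp),
      ⟨?_, fun a ha => ⟨hmem _ α hα a ha, hmem _ α⁻¹ hα' a ha⟩⟩, ?_⟩
    · have h := sum_fin_mod_mul_pow hn (Pi.single 0 1 - Pi.single 1 1 : ℕ → K) (1 : L)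
      simp only [one_pow, mul_one] at h
      rw [h, ← map_sum]
      have hzero : ∑ r ∈ Finset.range k, (Pi.single 0 1 - Pi.single 1 1 : ℕ → K) r = 0 := by
        simp only [Pi.sub_apply, Finset.sum_sub_distrib, Pi.single_apply, Finset.sum_ite_eq',
          Finset.mem_range]
        rw [if_pos (by omega), if_pos (by omega), sub_self]
      rw [hzero, map_zero, mul_zero]
    · have := hwt_mod_le hn (Pi.single 0 1 - Pi.single 1 1 : ℕ → K) {0, 1} fun r hr => by
        simp only [Finset.mem_insert, Finset.mem_singleton, not_or] at hr
        simp [hr.1, hr.2]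
      simpa using this
end

section
/- The minimum distances satisfy d(3, 6, 2) = 13 and d̄(3, 6, 2) = 26. -/
/-- Vandermonde argument behind the BCH bound: if the first `N` weighted power sums at distinct
points vanish and at most `N` weights are nonzero, then all weights vanish. -/
theorem eq_zero_of_sum_mul_pow_eq_zero {ι F : Type*} [Fintype ι] [Field F] {f g : ι → F}
    (hg : Function.Injective g) {N : ℕ} (hsum : ∀ k < N, ∑ i, f i * g i ^ k = 0)
    (hcard : {i | f i ≠ 0}.ncard ≤ N) : f = 0 := by
  classical
  by_contra hf
  obtain ⟨i₀, hi₀⟩ := Function.ne_iff.mp hf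
  have hi₀ : f i₀ ≠ 0 := hi₀
  set S : Finset ι := Finset.univ.filter (fun i => f i ≠ 0) with hS
  have hSmem : i₀ ∈ S := by simp [hS, hi₀]
  have hScard : S.card ≤ N := by
    rw [Set.ncard_eq_toFinset_card'] at hcard
    simpa [hS] using hcard
  have hpoly : ∀ p : Polynomial F, p.natDegree < N → ∑ i, f i * p.eval (g i) = 0 := by
    intro p hp
    simp_rw [Polynomial.eval_eq_sum_range' hp, Finset.mul_sum]
    rw [Finset.sum_comm]
    refine Finset.sum_eq_zero fun k hk => ?_
    have := hsum k (Finset.mem_range.mp hk)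
    simp_rw [mul_left_comm (f _)]
    rw [← Finset.mul_sum, this, mul_zero]
  set p : Polynomial F := ∏ j ∈ S.erase i₀, (Polynomial.X - Polynomial.C (g j)) with hp
  have hdeg : p.natDegree < N := by
    rw [hp, Polynomial.natDegree_finsetProd_X_sub_C_eq_card, Finset.card_erase_of_mem hSmem]
    have := Finset.card_pos.mpr ⟨i₀, hSmem⟩
    omega
  have hsum_p := hpoly p hdeg
  rw [Finset.sum_eq_single i₀] at hsum_p
  · refine mul_ne_zero hi₀ ?_ hsum_p
    rw [hp, Polynomial.eval_prod, Finset.prod_ne_zero_iff]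
    intro j hj
    simpa [sub_eq_zero] using fun h => (Finset.ne_of_mem_erase hj) (hg h).symm
  · intro j _ hj
    by_cases hfj : f j = 0
    · simp [hfj]
    · have hjS : j ∈ S.erase i₀ := by simp [hS, hj, hfj]
      rw [hp, Polynomial.eval_prod, Finset.prod_eq_zero hjS (by simp), mul_zero]
  · simp

/-- The coefficient vector of `∑ j < n / d, ε ^ j x ^ (d j)`. -/
def geomWord {K : Type*} [Field K] (n d : ℕ) (ε : K) (i : Fin n) : K :=
  if d ∣ (i : ℕ) then ε ^ ((i : ℕ) / d) else 0

theorem hwt_geomWord {K : Type*} [Field K] {n d e : ℕ} (hd : 0 < d) (hn : n = d * e) {ε : K}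
    (hε : ε ≠ 0) : hwt (geomWord n d ε) = e := by
  have hlt : ∀ j : Fin e, d * (j : ℕ) < n := fun j => by
    rw [hn]; exact Nat.mul_lt_mul_of_pos_left j.2 hd
  have hset : {i : Fin n | geomWord n d ε i ≠ 0} =
      Set.range (fun j : Fin e => (⟨d * (j : ℕ), hlt j⟩ : Fin n)) := by
    ext i
    simp only [geomWord, Set.mem_ofPred_eq, Set.mem_range]
    constructor
    · intro h
      obtain ⟨j, hj⟩ : d ∣ (i : ℕ) := by
        by_contra hdi
        simp [hdi] at h
      refine ⟨⟨j, ?_⟩, Fin.ext hj.symm⟩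
      have := i.2
      rw [hj] at this
      exact Nat.lt_of_mul_lt_mul_left (this.trans_eq hn)
    · rintro ⟨j, rfl⟩
      simp [hε]
  have hinj : Function.Injective (fun j : Fin e => (⟨d * (j : ℕ), hlt j⟩ : Fin n)) := by
    intro j k h
    have h' : d * (j : ℕ) = d * (k : ℕ) := congrArg Fin.val h
    exact Fin.ext (Nat.eq_of_mul_eq_mul_left hd h')
  rw [hwt, hset, ← Set.image_univ, Set.ncard_image_of_injective _ hinj, Set.ncard_univ,
    Nat.card_eq_fintype_card, Fintype.card_fin]

theorem sum_geomWord_mul_pow {K L : Type*} [Field K] [Field L] [Algebra K L] {n d e : ℕ}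
    (hd : 0 < d) (hn : n = d * e) (ε : K) (x : L) :
    ∑ i : Fin n, algebraMap K L (geomWord n d ε i) * x ^ (i : ℕ) =
      ∑ j ∈ Finset.range e, (algebraMap K L ε * x ^ d) ^ j := by
  symm
  rw [Finset.sum_range]
  refine Finset.sum_of_injOn
    (fun j : Fin e => (⟨d * (j : ℕ), by
      rw [hn]; exact Nat.mul_lt_mul_of_pos_left j.2 hd⟩ : Fin n)) ?_ ?_ ?_ ?_
  · intro j _ k _ h
    have h' : d * (j : ℕ) = d * (k : ℕ) := congrArg Fin.val h
    exact Fin.ext (Nat.eq_of_mul_eq_mul_left hd h')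
  · simp
  · intro i _ hi
    have hdi : ¬ d ∣ (i : ℕ) := by
      rintro ⟨j, hj⟩
      refine hi ⟨⟨j, ?_⟩, by simp, Fin.ext hj.symm⟩
      have := i.2
      rw [hj] at this
      exact Nat.lt_of_mul_lt_mul_left (this.trans_eq hn)
    simp [geomWord, hdi]
  · intro j _
    simp [geomWord, hd, mul_pow, pow_mul]

theorem geom_sum_eq_zero_of_pow_eq_one {F : Type*} [Field F] {r : F} {e : ℕ} (hr : r ^ e = 1)
    (hr1 : r ≠ 1) : ∑ j ∈ Finset.range e, r ^ j = 0 := by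
  rw [geom_sum_eq hr1, hr, sub_self, zero_div]

theorem mem_Iset_of_le_twelve {a : ℕ} (h1 : 1 ≤ a) (h2 : a ≤ 12) : a ∈ Iset 3 6 2 := by
  refine ⟨h1, by omega, ?_⟩
  interval_cases a <;> simp [wtq]

theorem not_thirteen_dvd_of_mem_Iset {a : ℕ} (ha : a ∈ Iset 3 6 2) : ¬ 13 ∣ a := by
  rintro ⟨k, rfl⟩
  obtain ⟨h1, h2, h3⟩ := ha
  have hk1 : 1 ≤ k := by omega
  have hk2 : k ≤ 55 := by omega
  interval_cases k <;> simp [wtq] at h3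

theorem pow_mul_ne_one_of_mem_Iset {L : Type*} [Field L] {α : L} (hα : orderOf α = 728) {a : ℕ}
    (ha : a ∈ Iset 3 6 2) : α ^ (a * 56) ≠ 1 := by
  intro h
  have := orderOf_dvd_of_pow_eq_one h
  rw [hα] at this
  exact not_thirteen_dvd_of_mem_Iset ha (by omega)

theorem geomWord_one_mem_inOmega {K L : Type*} [Field K] [Field L] [Algebra K L] {α : L}
    (hα : orderOf α = 728) : inOmega 3 6 2 α (geomWord (3 ^ 6 - 1) 56 (1 : K)) := by
  intro a ha
  simp_rw [pow_mul α a]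
  rw [sum_geomWord_mul_pow (e := 13) (by norm_num) (by norm_num)]
  apply geom_sum_eq_zero_of_pow_eq_one
  · rw [map_one, one_mul, ← pow_mul, ← pow_mul, show a * (56 * 13) = 728 * a by ring, pow_mul, ← hα,
      pow_orderOf_eq_one, one_pow]
  · rw [map_one, one_mul, ← pow_mul]
    exact pow_mul_ne_one_of_mem_Iset hα ha

theorem sum_geomWord_neg_one {K L : Type*} [Field K] [Field L] [Algebra K L] {α : L}
    (hα : orderOf α = 728) {a : ℕ} (ha : a ∈ Iset 3 6 2) :
    ∑ i, algebraMap K L (geomWord (3 ^ 6 - 1) 28 (-1 : K) i) * α ^ (a * (i : ℕ)) = 0 := by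
  simp_rw [pow_mul α a]
  rw [sum_geomWord_mul_pow (e := 26) (by norm_num) (by norm_num)]
  apply geom_sum_eq_zero_of_pow_eq_one
  · rw [map_neg, map_one, neg_one_mul, Even.neg_pow (by decide), ← pow_mul, ← pow_mul,
      show a * (28 * 26) = 728 * a by ring, pow_mul, ← hα, pow_orderOf_eq_one, one_pow]
  · intro h
    apply pow_mul_ne_one_of_mem_Iset hα ha
    calc α ^ (a * 56) = (algebraMap K L (-1) * (α ^ a) ^ 28) ^ 2 := by
          rw [map_neg, map_one, neg_one_mul, neg_sq]; ring
      _ = 1 := by rw [h, one_pow]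

theorem geomWord_neg_one_mem_inOmegaBar {K L : Type*} [Field K] [Field L] [Algebra K L] {α : L}
    (hα : orderOf α = 728) (h2 : (-1 : L) ≠ 1) :
    inOmegaBar 3 6 2 α (geomWord (3 ^ 6 - 1) 28 (-1 : K)) := by
  refine ⟨?_, fun a ha => ⟨sum_geomWord_neg_one hα ha,
    sum_geomWord_neg_one (by rw [← hα, orderOf_eq_orderOf_iff]; simp) ha⟩⟩
  have h := sum_geomWord_mul_pow (n := 3 ^ 6 - 1) (d := 28) (e := 26) (by norm_num) (by norm_num)
    (-1 : K) (1 : L)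
  simp only [one_pow, mul_one] at h
  rw [h]
  apply geom_sum_eq_zero_of_pow_eq_one
  · rw [map_neg, map_one, Even.neg_one_pow (by decide)]
  · simpa using h2

theorem pow_val_injective {L : Type*} [Field L] {α : L} {n : ℕ} (hα : orderOf α = n) :
    Function.Injective (fun i : Fin n => α ^ (i : ℕ)) := by
  intro i j h
  exact Fin.ext (pow_injOn_Iio_orderOf (by simp [hα]) (by simp [hα]) h)

theorem thirteen_le_hwt_of_inOmega {K L : Type*} [Field K] [Field L] [Algebra K L] {α : L}
    (hα : orderOf α = 3 ^ 6 - 1) {c : Fin (3 ^ 6 - 1) → K} (hc : c ≠ 0)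
    (h : inOmega 3 6 2 α c) : 13 ≤ hwt c := by
  have hα0 : α ≠ 0 := by
    rintro rfl
    simp at hα
  by_contra! hlt
  have hzero := eq_zero_of_sum_mul_pow_eq_zero (N := 12)
    (f := fun i => algebraMap K L (c i) * α ^ (i : ℕ)) (pow_val_injective hα) ?_ ?_
  · refine hc (funext fun i => ?_)
    simpa [hα0] using congrFun hzero i
  · intro k hk
    rw [← h (k + 1) (mem_Iset_of_le_twelve (by omega) (by omega))]
    refine Finset.sum_congr rfl fun i _ => ?_
    ring
  · simpa [hα0, hwt] using Nat.le_of_lt_succ hlt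

theorem twentySix_le_hwt_of_inOmegaBar {K L : Type*} [Field K] [Field L] [Algebra K L] {α : L}
    (hα : orderOf α = 3 ^ 6 - 1) {c : Fin (3 ^ 6 - 1) → K} (hc : c ≠ 0)
    (h : inOmegaBar 3 6 2 α c) : 26 ≤ hwt c := by
  have hα0 : α ≠ 0 := by
    rintro rfl
    simp at hα
  by_contra! hlt
  have hzero := eq_zero_of_sum_mul_pow_eq_zero (N := 25)
    (f := fun i => algebraMap K L (c i) * α⁻¹ ^ (12 * (i : ℕ))) (pow_val_injective hα) ?_ ?_
  · refine hc (funext fun i => ?_)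
    simpa [hα0] using congrFun hzero i
  · intro k hk
    have hcancel : ∀ l i : ℕ, α⁻¹ ^ (l * i) * α ^ (l * i) = 1 := fun l i => by
      rw [← mul_pow, inv_mul_cancel₀ hα0, one_pow]
    rcases lt_trichotomy k 12 with hk' | rfl | hk'
    · obtain ⟨l, hl⟩ : ∃ l, 12 = l + k := ⟨12 - k, by omega⟩
      rw [← (h.2 l (mem_Iset_of_le_twelve (by omega) (by omega))).2]
      refine Finset.sum_congr rfl fun i _ => ?_
      rw [hl, add_mul, pow_add, mul_assoc, mul_assoc, ← pow_mul, mul_comm (i : ℕ) k, hcancel,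
        mul_one]
    · rw [← h.1]
      refine Finset.sum_congr rfl fun i _ => ?_
      rw [mul_assoc, ← pow_mul, mul_comm (i : ℕ) 12, hcancel, mul_one]
    · obtain ⟨l, rfl⟩ : ∃ l, k = 12 + l := ⟨k - 12, by omega⟩
      rw [← (h.2 l (mem_Iset_of_le_twelve (by omega) (by omega))).1]
      refine Finset.sum_congr rfl fun i _ => ?_
      rw [← pow_mul, mul_comm (i : ℕ), add_mul, pow_add, mul_assoc, ← mul_assoc (α⁻¹ ^ _), hcancel,
        one_mul]
  · simpa [hα0, hwt] using Nat.le_of_lt_succ hlt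

theorem ne_zero_of_hwt_pos {R : Type*} [Zero R] {n : ℕ} {c : Fin n → R} (h : 0 < hwt c) :
    c ≠ 0 := by
  rintro rfl
  simp [hwt] at h

/-- The minimum distance of `Ω(3, 6, 2)` equals `13` and that of
`Ω̄(3, 6, 2)` equals `26`. -/
theorem stmt16
    (K L : Type) [Field K] [Fintype K] [Field L] [Fintype L] [Algebra K L]
    (hcardK : Fintype.card K = 3) (hcardL : Fintype.card L = 3 ^ 6)
    (α : L) (hα : orderOf α = 3 ^ 6 - 1) :
    IsLeast {w | ∃ c : Fin (3 ^ 6 - 1) → K,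
        c ≠ 0 ∧ inOmega 3 6 2 α c ∧ hwt c = w} 13 ∧
    IsLeast {w | ∃ c : Fin (3 ^ 6 - 1) → K,
        c ≠ 0 ∧ inOmegaBar 3 6 2 α c ∧ hwt c = w} 26 := by
  have hα' : orderOf α = 728 := hα
  have h2 : (-1 : L) ≠ 1 := by
    intro h
    have h729 : (729 : L) = 0 := by
      have := Nat.cast_card_eq_zero L
      rw [hcardL] at this
      exact_mod_cast this
    exact one_ne_zero (α := L) (by linear_combination h729 + 364 * h)
  refine ⟨⟨?_, ?_⟩, ⟨?_, ?_⟩⟩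
  · have hw : hwt (geomWord (3 ^ 6 - 1) 56 (1 : K)) = 13 :=
      hwt_geomWord (by norm_num) (by norm_num) one_ne_zero
    exact ⟨_, ne_zero_of_hwt_pos (by omega), geomWord_one_mem_inOmega hα', hw⟩
  · rintro w ⟨c, hc, h, rfl⟩
    exact thirteen_le_hwt_of_inOmega hα hc h
  · have hw : hwt (geomWord (3 ^ 6 - 1) 28 (-1 : K)) = 26 :=
      hwt_geomWord (by norm_num) (by norm_num) (neg_ne_zero.mpr one_ne_zero)
    exact ⟨_, ne_zero_of_hwt_pos (by omega), geomWord_neg_one_mem_inOmegaBar hα' h2, hw⟩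
  · rintro w ⟨c, hc, h, rfl⟩
    exact twentySix_le_hwt_of_inOmegaBar hα hc h
end

section
/- The minimum distances satisfy d(3, 4, 2) ≤ 16 and d̄(3, 4, 2) ≤ 32. -/
/-- Coefficients in the basis `1, β, β², β³` of `β ^ k`, for `β` with `β ^ 4 = 1 - β`. -/
def powCoeff : ℕ → ℤ × ℤ × ℤ × ℤ
  | 0 => (1, 0, 0, 0)
  | k + 1 => match powCoeff k with
    | (a, b, c, d) => (d, a - d, b, c)

/-- The word with entry `1` on `P`, entry `-1` on `M` and entry `0` elsewhere. -/
def signWord (P M : List ℕ) (j : ℕ) : ℤ :=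
  if j ∈ P then 1 else if j ∈ M then -1 else 0

/-- The syndrome of the word `w` at exponent `a`, in the basis `1, β, β², β³`, vanishes
modulo `3`. -/
def SyndromeVanishes (w : ℕ → ℤ) (a : ℕ) : Prop :=
  (3 : ℤ) ∣ ∑ j ∈ Finset.range 80, w j * (powCoeff (a * j % 80)).1 ∧
  (3 : ℤ) ∣ ∑ j ∈ Finset.range 80, w j * (powCoeff (a * j % 80)).2.1 ∧
  (3 : ℤ) ∣ ∑ j ∈ Finset.range 80, w j * (powCoeff (a * j % 80)).2.2.1 ∧
  (3 : ℤ) ∣ ∑ j ∈ Finset.range 80, w j * (powCoeff (a * j % 80)).2.2.2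

instance (w : ℕ → ℤ) (a : ℕ) : Decidable (SyndromeVanishes w a) := by
  unfold SyndromeVanishes; infer_instance

/-- A word of weight `13` in `Ω(3, 4, 2)`. -/
def omegaWord : ℕ → ℤ :=
  signWord [11, 16, 19, 25, 27, 33] [9, 46, 51, 54, 63, 66, 68]

/-- A word of weight `28` in `Ω̄(3, 4, 2)`. -/
def omegaBarWord : ℕ → ℤ :=
  signWord [5, 7, 8, 11, 18, 20, 27, 33, 39, 45, 57, 59, 70, 71]
    [3, 9, 15, 22, 24, 31, 34, 35, 37, 51, 52, 63, 65, 77]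

theorem omegaWord_syndrome :
    ∀ a < 80, 1 ≤ a → wtq 3 a ≤ 2 → SyndromeVanishes omegaWord a := by
  decide +kernel

theorem omegaBarWord_syndrome :
    ∀ a < 80, wtq 3 a ≤ 2 →
      SyndromeVanishes omegaBarWord a ∧ SyndromeVanishes omegaBarWord (80 - a) := by
  decide +kernel

theorem pow_eq_powCoeff {L : Type*} [CommRing L] {β : L} (hβ : β ^ 4 = 1 - β) (k : ℕ) :
    β ^ k = (powCoeff k).1 + (powCoeff k).2.1 * β + (powCoeff k).2.2.1 * β ^ 2
      + (powCoeff k).2.2.2 * β ^ 3 := by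
  induction k with
  | zero => simp [powCoeff]
  | succ k ih =>
    rw [pow_succ, ih]
    simp only [powCoeff]
    push_cast
    linear_combination ((powCoeff k).2.2.2 : L) * hβ

theorem sum_range_eq_zero {L : Type*} [CommRing L] {β : L} (h3 : (3 : L) = 0)
    (hβ : β ^ 4 = 1 - β) (h80 : β ^ 80 = 1) {w : ℕ → ℤ} {a : ℕ}
    (hw : SyndromeVanishes w a) :
    ∑ j ∈ Finset.range 80, (w j : L) * β ^ (a * j) = 0 := by
  have cast_zero {z : ℤ} (hz : (3 : ℤ) ∣ z) : (z : L) = 0 := by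
    obtain ⟨t, rfl⟩ := hz
    push_cast
    rw [h3, zero_mul]
  obtain ⟨h₀, h₁, h₂, h₃⟩ := hw
  replace h₀ := cast_zero h₀
  replace h₁ := cast_zero h₁
  replace h₂ := cast_zero h₂
  replace h₃ := cast_zero h₃
  push_cast at h₀ h₁ h₂ h₃
  calc ∑ j ∈ Finset.range 80, (w j : L) * β ^ (a * j)
      = (∑ j ∈ Finset.range 80, (w j : L) * ((powCoeff (a * j % 80)).1 : L))
        + (∑ j ∈ Finset.range 80, (w j : L) * ((powCoeff (a * j % 80)).2.1 : L)) * β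
        + (∑ j ∈ Finset.range 80, (w j : L) * ((powCoeff (a * j % 80)).2.2.1 : L)) * β ^ 2
        + (∑ j ∈ Finset.range 80, (w j : L) * ((powCoeff (a * j % 80)).2.2.2 : L)) * β ^ 3 := by
        simp only [Finset.sum_mul, ← Finset.sum_add_distrib]
        refine Finset.sum_congr rfl fun j _ => ?_
        rw [pow_eq_pow_mod (a * j) h80, pow_eq_powCoeff hβ]
        ring
    _ = 0 := by rw [h₀, h₁, h₂, h₃]; ring

open Polynomial in
/-- In a field of characteristic `3` containing a primitive 80th root of unity, some primitive
80th root of unity is a root of `X ^ 4 + X - 1`. -/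
theorem exists_primitiveRoot_pow_four {L : Type*} [Field L] (h3 : (3 : L) = 0) {α : L}
    (hα : IsPrimitiveRoot α 80) :
    ∃ β : L, IsPrimitiveRoot β 80 ∧ β ^ 4 = 1 - β := by
  classical
  by_contra! hno
  let g : L[X] := X ^ 28 - X ^ 25 + X ^ 24 + X ^ 22 + X ^ 21 - X ^ 19 + X ^ 17 + X ^ 16 - X ^ 15
    - X ^ 14 - X ^ 10 + X ^ 7 - X ^ 6 + X ^ 4 - X ^ 3 - X ^ 2 - X - 1
  have hdeg : g.natDegree = 28 := by
    simp only [g]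
    compute_degree!
  have hg0 : g ≠ 0 := fun h => by simp [h] at hdeg
  have hsub : primitiveRoots 80 L ⊆ g.roots.toFinset := by
    intro b hb
    rw [mem_primitiveRoots (by norm_num)] at hb
    rw [Multiset.mem_toFinset, mem_roots hg0]
    have h40 : b ^ 40 = -1 := by
      have hsq : (b ^ 40 - 1) * (b ^ 40 + 1) = 0 := by linear_combination hb.pow_eq_one
      rcases mul_eq_zero.mp hsq with h | h
      · exact absurd (sub_eq_zero.mp h) (hb.pow_ne_one_of_pos_of_lt (by norm_num) (by norm_num))
      · exact eq_neg_of_add_eq_zero_left h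
    have hΦ : b ^ 32 - b ^ 24 + b ^ 16 - b ^ 8 + 1 = 0 := by
      have hmul : (b ^ 8 + 1) * (b ^ 32 - b ^ 24 + b ^ 16 - b ^ 8 + 1) = 0 := by
        linear_combination h40
      refine (mul_eq_zero.mp hmul).resolve_left fun h => ?_
      refine hb.pow_ne_one_of_pos_of_lt (l := 16) (by norm_num) (by norm_num) ?_
      linear_combination (b ^ 8 - 1) * h
    have hfac : (b ^ 4 + b - 1) * g.eval b = 0 := by
      simp only [g, eval_add, eval_sub, eval_pow, eval_X, eval_one]
      linear_combination hΦ + (b ^ 25 - b ^ 16 + b ^ 8 - b ^ 7 - b ^ 4) * h3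
    refine (mul_eq_zero.mp hfac).resolve_left fun h => hno b hb ?_
    linear_combination h
  have hcard := (Finset.card_le_card hsub).trans
    ((Multiset.toFinset_card_le _).trans (card_roots' g))
  rw [hα.card_primitiveRoots, hdeg] at hcard
  revert hcard
  decide

/-- The permutation of exponents taking `i` to `l * i` modulo `n`, when multiplication by `l` is
realised by `i ↦ (β ^ l) ^ i` for a primitive `n`-th root of unity `β ^ l`. -/
theorem bijective_mul_mod {L : Type*} [CommRing L] {β : L} {n l : ℕ} (hn : 0 < n)
    (h1 : β ^ n = 1) (hβl : IsPrimitiveRoot (β ^ l) n) :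
    Function.Bijective fun i : Fin n => (⟨l * i % n, Nat.mod_lt _ hn⟩ : Fin n) := by
  rw [← Finite.injective_iff_bijective]
  intro i j hij
  refine Fin.ext (hβl.pow_inj i.2 j.2 ?_)
  have hmod : l * (i : ℕ) % n = l * j % n := congrArg Fin.val hij
  rw [← pow_mul, ← pow_mul, pow_eq_pow_mod _ h1, hmod, ← pow_eq_pow_mod _ h1]

theorem sum_mul_mod_eq_zero {L : Type*} [CommRing L] {β : L} (h3 : (3 : L) = 0)
    (hβ : β ^ 4 = 1 - β) (h80 : β ^ 80 = 1) {l : ℕ} (hβl : IsPrimitiveRoot (β ^ l) 80)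
    {w : ℕ → ℤ} {a : ℕ} (hw : SyndromeVanishes w a) :
    ∑ i : Fin 80, (w (l * i % 80) : L) * (β ^ l) ^ (a * (i : ℕ)) = 0 := by
  rw [← sum_range_eq_zero h3 hβ h80 hw,
    ← Fin.sum_univ_eq_sum_range (fun j => (w j : L) * β ^ (a * j)),
    ← (bijective_mul_mod (by norm_num) h80 hβl).sum_comp
      fun j : Fin 80 => (w j : L) * β ^ (a * (j : ℕ))]
  refine Finset.sum_congr rfl fun i _ => ?_
  rw [← pow_mul, pow_eq_pow_mod (l * (a * i)) h80, pow_eq_pow_mod (a * (l * i % 80)) h80,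
    Nat.mul_mod_mod, mul_left_comm]

theorem hwt_comp_le {K : Type*} [Ring K] {n : ℕ} {σ : Fin n → Fin n}
    (hσ : Function.Injective σ) (w : ℕ → ℤ) :
    hwt (fun i => ((w (σ i) : ℤ) : K)) ≤ (Finset.univ.filter fun j : Fin n => w j ≠ 0).card := by
  rw [hwt, ← Set.ncard_coe_finset]
  refine Set.ncard_le_ncard_of_injOn σ (fun i hi => ?_) hσ.injOn
  simp only [Finset.coe_filter, Finset.mem_univ, true_and, Set.mem_ofPred_eq] at hi ⊢
  exact fun h => hi (by simp [h])

/-- The minimum distance of `Ω(3, 4, 2)` is at most `16` and that of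
`Ω̄(3, 4, 2)` is at most `32`, i.e. each code has a nonzero codeword of the corresponding
Hamming weight. -/
theorem stmt17
    (K L : Type) [Field K] [Fintype K] [Field L] [Fintype L] [Algebra K L]
    (hcardK : Fintype.card K = 3) (hcardL : Fintype.card L = 3 ^ 4)
    (α : L) (hα : orderOf α = 3 ^ 4 - 1) :
    (∃ c : Fin (3 ^ 4 - 1) → K, c ≠ 0 ∧ inOmega 3 4 2 α c ∧ hwt c ≤ 16) ∧
    (∃ c : Fin (3 ^ 4 - 1) → K, c ≠ 0 ∧ inOmegaBar 3 4 2 α c ∧ hwt c ≤ 32) := by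
  have h3K : (3 : K) = 0 := by
    simpa [hcardK] using FiniteField.cast_card_eq_zero K
  have h3 : (3 : L) = 0 := by
    rw [← map_ofNat (algebraMap K L) 3, h3K, map_zero]
  have hα' : IsPrimitiveRoot α 80 := IsPrimitiveRoot.iff_orderOf.mpr hα
  obtain ⟨β, hβprim, hβ⟩ := exists_primitiveRoot_pow_four h3 hα'
  have h80 := hβprim.pow_eq_one
  obtain ⟨l, -, rfl⟩ := hβprim.eq_pow_of_pow_eq_one hα'.pow_eq_one
  have hσ := bijective_mul_mod (by norm_num) h80 hα'
  have ne_zero {w : ℕ → ℤ} (j : Fin 80) (hj : w j = 1) :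
      (fun i : Fin 80 => ((w (l * i % 80) : ℤ) : K)) ≠ 0 := by
    obtain ⟨i, rfl⟩ := hσ.surjective j
    intro h
    have hi := congrFun h i
    simp only at hj
    simp [hj] at hi
  refine ⟨⟨fun i => (omegaWord (l * i % 80) : ℤ), ne_zero 11 (by decide), ?_, ?_⟩,
    ⟨fun i => (omegaBarWord (l * i % 80) : ℤ), ne_zero 5 (by decide), ⟨?_, ?_⟩, ?_⟩⟩
  · rintro a ⟨ha1, ha2, ha3⟩
    simp only [map_intCast]
    exact sum_mul_mod_eq_zero h3 hβ h80 hα' (omegaWord_syndrome a (by omega) ha1 ha3)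
  · exact (hwt_comp_le hσ.injective omegaWord).trans (by decide)
  · have h := sum_mul_mod_eq_zero h3 hβ h80 hα'
      (omegaBarWord_syndrome 0 (by norm_num) (by decide)).1
    simpa using h
  · rintro a ⟨ha1, ha2, ha3⟩
    simp only [map_intCast]
    obtain ⟨h, h'⟩ := omegaBarWord_syndrome a (by omega) ha3
    refine ⟨sum_mul_mod_eq_zero h3 hβ h80 hα' h, ?_⟩
    have hinv (i : ℕ) : (β ^ l)⁻¹ ^ (a * i) = (β ^ l) ^ ((80 - a) * i) := by
      refine (inv_pow _ _).trans (inv_eq_of_mul_eq_one_right ?_)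
      rw [← pow_add, ← add_mul, Nat.add_sub_cancel' (by omega), pow_mul, hα'.pow_eq_one, one_pow]
    simp only [hinv]
    exact sum_mul_mod_eq_zero h3 hβ h80 hα' h'
  · exact (hwt_comp_le hσ.injective omegaBarWord).trans (by decide)
end
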